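/- Let 𝒜 be a compact subset of 𝔗₊(ℋ) on which the quantum entropy H is continuous. Then lim_{k→+∞} sup_{A∈𝒜, Φ∈𝔏⁺≤1(ℋ,ℋ')} ( H_Φ(A) − H_Φ^k(A) ) = 0, i.e. the k-order approximators of output entropy converge to the output entropy uniformly over all A in 𝒜 and all positive trace-non-increasing maps Φ simultaneously. -/

import Mathlib

open scoped ENNReal NNReal
open Filter Topology Classical
attribute [local instance] Classical.propDecidable

noncomputable section

namespace QIT

section Defs

variable {E F G : Type*}
variable [NormedAddCommGroup E] [InnerProductSpace ℂ E] [CompleteSpace E]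
variable [NormedAddCommGroup F] [InnerProductSpace ℂ F] [CompleteSpace F]
variable [NormedAddCommGroup G] [InnerProductSpace ℂ G] [CompleteSpace G]

/-- The real part of `⟪x, A x⟫`. -/
def qf (A : E →L[ℂ] E) (x : E) : ℝ := (inner ℂ x (A x) : ℂ).re

/-- The trace of a positive operator, as the supremum of finite diagonal sums over
finite orthonormal families.  For positive operators this coincides with the usual
trace (with value `∞` when the operator is not trace class). -/
def traceENN (A : E →L[ℂ] E) : ℝ≥0∞ :=
  ⨆ (n : ℕ) (e : Fin n → E) (_ : Orthonormal ℂ e), ∑ i, ENNReal.ofReal (qf A (e i))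

/-- The trace norm `‖A‖₁`, as the supremum of `∑ |⟪e i, A (f i)⟫|` over pairs of finite
orthonormal families; it is finite exactly on trace-class operators. -/
def traceNorm (A : E →L[ℂ] E) : ℝ≥0∞ :=
  ⨆ (n : ℕ) (e : Fin n → E) (f : Fin n → E) (_ : Orthonormal ℂ e) (_ : Orthonormal ℂ f),
    ∑ i, ENNReal.ofReal ‖(inner ℂ (e i) (A (f i)) : ℂ)‖

/-- `A` is a trace-class operator. -/
def IsTC (A : E →L[ℂ] E) : Prop := traceNorm A ≠ ∞

/-- The cone `𝔗₊(E)` of positive trace-class operators. -/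
def posTC (E : Type*) [NormedAddCommGroup E] [InnerProductSpace ℂ E] [CompleteSpace E] :
    Set (E →L[ℂ] E) := {A | A.IsPositive ∧ IsTC A}

/-- The set `𝔖(E)` of states (density operators). -/
def states (E : Type*) [NormedAddCommGroup E] [InnerProductSpace ℂ E] [CompleteSpace E] :
    Set (E →L[ℂ] E) := {A | A.IsPositive ∧ traceENN A = 1}

/-- The extended classical entropy `H({x_i}) = ∑ η(x_i) − η(∑ x_i)` of a nonnegative
summable family, written in the equivalent homogeneous form `(∑ x) · H({x_i/∑x})`. -/
def clEntropy {ι : Type*} (x : ι → ℝ) : ℝ≥0∞ :=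
  ENNReal.ofReal (∑' i, x i) *
    ∑' i, ENNReal.ofReal (Real.negMulLog (x i / (∑' j, x j)))

/-- An orthonormal subset with dense span (an orthonormal basis, as a set). -/
def IsONB (s : Set E) : Prop :=
  Orthonormal ℂ ((↑) : s → E) ∧ Dense ((Submodule.span ℂ s : Submodule ℂ E) : Set E)

/-- The quantum (von Neumann) entropy `H(A) = Tr η(A) − η(Tr A)` of a positive trace-class
operator, realized as the infimum over all orthonormal bases of the classical entropy of
the diagonal of `A` (the infimum is attained on an eigenbasis of `A`). -/
def qEntropy (A : E →L[ℂ] E) : ℝ≥0∞ :=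
  ⨅ (s : Set E) (_ : IsONB s), clEntropy fun v : s => qf A v

theorem exists_isONB (E : Type*) [NormedAddCommGroup E] [InnerProductSpace ℂ E]
    [CompleteSpace E] : ∃ s : Set E, IsONB s := by
  obtain ⟨w, b, hb⟩ := exists_hilbertBasis ℂ E
  refine ⟨w, ?_, ?_⟩
  · have h := b.orthonormal
    rwa [hb] at h
  · have h := b.dense_span
    rw [hb, Subtype.range_coe] at h
    rwa [Submodule.dense_iff_topologicalClosure_eq_top]

/-- A fixed orthonormal basis (as a set). -/
def stdONB (E : Type*) [NormedAddCommGroup E] [InnerProductSpace ℂ E] [CompleteSpace E] :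
    Set E := (exists_isONB E).choose

/-- The `ℂ`-valued trace, computed in a fixed orthonormal basis; for trace-class
operators it does not depend on the choice of the basis. -/
def traceC (A : E →L[ℂ] E) : ℂ := ∑' v : stdONB E, (inner ℂ (v : E) (A v) : ℂ)

/-- Continuity (including finiteness) of an `ℝ≥0∞`-valued function on a subset of
operators, with respect to the trace-norm distance. -/
def ContOn (f : (E →L[ℂ] E) → ℝ≥0∞) (𝒜 : Set (E →L[ℂ] E)) : Prop :=
  (∀ A ∈ 𝒜, f A ≠ ∞) ∧
  ∀ A ∈ 𝒜, ∀ ε : ℝ, 0 < ε → ∃ δ : ℝ, 0 < δ ∧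
    ∀ B ∈ 𝒜, traceNorm (B - A) < ENNReal.ofReal δ → |(f B).toReal - (f A).toReal| < ε

/-- Continuity of a real-valued function on a subset of operators with respect to the
trace-norm distance. -/
def RContOn (g : (E →L[ℂ] E) → ℝ) (𝒜 : Set (E →L[ℂ] E)) : Prop :=
  ∀ A ∈ 𝒜, ∀ ε : ℝ, 0 < ε → ∃ δ : ℝ, 0 < δ ∧
    ∀ B ∈ 𝒜, traceNorm (B - A) < ENNReal.ofReal δ → |g B - g A| < ε

/-- Boundedness of an `ℝ≥0∞`-valued function on a set. -/
def BddOn (f : (E →L[ℂ] E) → ℝ≥0∞) (𝒜 : Set (E →L[ℂ] E)) : Prop :=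
  ∃ C : ℝ, ∀ A ∈ 𝒜, f A ≤ ENNReal.ofReal C

/-- Convergence of a sequence of operators in the trace norm. -/
def TendstoTN (A : ℕ → (E →L[ℂ] E)) (A₀ : E →L[ℂ] E) : Prop :=
  ∀ ε : ℝ, 0 < ε → ∃ N : ℕ, ∀ n ≥ N, traceNorm (A n - A₀) < ENNReal.ofReal ε

/-- A positive linear map from the trace class of `E` to the trace class of `F`
(the values of `toFun` outside the trace class are irrelevant). -/
structure TraceMap (E F : Type*) [NormedAddCommGroup E] [InnerProductSpace ℂ E]
    [CompleteSpace E] [NormedAddCommGroup F] [InnerProductSpace ℂ F] [CompleteSpace F] where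
  toFun : (E →L[ℂ] E) → (F →L[ℂ] F)
  map_add : ∀ A B, IsTC A → IsTC B → toFun (A + B) = toFun A + toFun B
  map_smul : ∀ (c : ℂ) A, IsTC A → toFun (c • A) = c • toFun A
  maps_tc : ∀ A, IsTC A → IsTC (toFun A)
  pos : ∀ A, IsTC A → A.IsPositive → (toFun A).IsPositive

/-- A trace-non-increasing map. -/
def TraceMap.TNI (Φ : TraceMap E F) : Prop :=
  ∀ A, IsTC A → A.IsPositive → traceENN (Φ.toFun A) ≤ traceENN A

/-- A trace-preserving map. -/
def TraceMap.TP (Φ : TraceMap E F) : Prop :=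
  ∀ A, IsTC A → A.IsPositive → traceENN (Φ.toFun A) = traceENN A

/-- A map bounded with respect to the trace norm. -/
def TraceMap.Bounded (Φ : TraceMap E F) : Prop :=
  ∃ C : ℝ≥0, ∀ A, traceNorm (Φ.toFun A) ≤ (C : ℝ≥0∞) * traceNorm A

/-- The output entropy `H_Φ = H ∘ Φ`. -/
def outEntropy (Φ : TraceMap E F) (A : E →L[ℂ] E) : ℝ≥0∞ := qEntropy (Φ.toFun A)

/-- The rank-one operator `|x⟩⟨x|`. -/
def rankOne (x : E) : E →L[ℂ] E := (innerSL ℂ x).smulRight x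

/-- The rank-one operator `|x⟩⟨y|`. -/
def rankOneM (x y : E) : E →L[ℂ] E := (innerSL ℂ y).smulRight x

end Defs

section Defs2

variable {E F G : Type*}
variable [NormedAddCommGroup E] [InnerProductSpace ℂ E] [CompleteSpace E]
variable [NormedAddCommGroup F] [InnerProductSpace ℂ F] [CompleteSpace F]
variable [NormedAddCommGroup G] [InnerProductSpace ℂ G] [CompleteSpace G]

/-- The completely positive map `A ↦ ∑ᵢ Vᵢ A Vᵢ*` defined by a sequence of Kraus
operators. -/
def krausMap (V : ℕ → (E →L[ℂ] F)) (A : E →L[ℂ] E) : F →L[ℂ] F :=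
  ∑' i, V i ∘L A ∘L ContinuousLinearMap.adjoint (V i)

/-- The Kraus condition `∑ᵢ Vᵢ* Vᵢ ≤ I` (all partial sums are dominated by `I`). -/
def KrausTNI (V : ℕ → (E →L[ℂ] F)) : Prop :=
  ∀ n : ℕ,
    ((1 : E →L[ℂ] E) - ∑ i ∈ Finset.range n, ContinuousLinearMap.adjoint (V i) ∘L V i).IsPositive

/-- The Kraus condition `∑ᵢ Vᵢ* Vᵢ = I` (strong convergence), i.e. trace preservation. -/
def KrausTP (V : ℕ → (E →L[ℂ] F)) : Prop :=
  ∀ x : E, HasSum (fun i => (ContinuousLinearMap.adjoint (V i)) (V i x)) x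

/-- `(Φ, Φt)` is a complementary pair of quantum operations: for some Kraus
representation `Φ(·) = ∑ᵢ Vᵢ (·) Vᵢ*` and some orthonormal basis `{bᵢ}` of `G`,
`Φt(A) = ∑_{i,j} Tr[Vᵢ A Vⱼ*] |bᵢ⟩⟨bⱼ|` (characterized by its matrix entries). -/
def IsComplementaryPair (Φ : TraceMap E F) (Φt : TraceMap E G) : Prop :=
  ∃ (V : ℕ → (E →L[ℂ] F)) (b : HilbertBasis ℕ ℂ G),
    KrausTNI V ∧
    (∀ A, IsTC A → Φ.toFun A = krausMap V A) ∧
    (∀ A, IsTC A → ∀ i j : ℕ,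
      (inner ℂ (b i) (Φt.toFun A (b j)) : ℂ) =
        traceC (V i ∘L A ∘L ContinuousLinearMap.adjoint (V j)))

/-- A map (on trace-class operators) preserves continuity of the entropy:
its output entropy is continuous on every subset of the positive trace-class cone on
which the von Neumann entropy is continuous. -/
def PCE (Φf : (E →L[ℂ] E) → (F →L[ℂ] F)) : Prop :=
  ∀ 𝒜 : Set (E →L[ℂ] E), 𝒜 ⊆ posTC E → ContOn qEntropy 𝒜 →
    ContOn (fun A => qEntropy (Φf A)) 𝒜

/-- `μ` is the sequence of nonzero eigenvalues (with multiplicities, possibly padded by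
zeros) of the diagonalizable positive operator `T`, every vector orthogonal to the
eigenvectors being annihilated by `T`. -/
def IsEigenSeq (T : E →L[ℂ] E) (μ : ℕ → ℝ) : Prop :=
  ∃ e : ℕ → E,
    (∀ i j, i ≠ j → (inner ℂ (e i) (e j) : ℂ) = 0) ∧
    (∀ i, (μ i ≠ 0 → ‖e i‖ = 1) ∧ (μ i = 0 → e i = 0)) ∧
    (∀ i, T (e i) = (μ i : ℂ) • e i) ∧
    (∀ x : E, (∀ i, (inner ℂ (e i) x : ℂ) = 0) → T x = 0)

/-- `ν` is the sequence of singular values of `V` (eigenvalues of `√(V*V)`,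
equivalently `ν²` are the eigenvalues of `V*V`). -/
def IsSingularValues (V : E →L[ℂ] F) (ν : ℕ → ℝ) : Prop :=
  (∀ i, 0 ≤ ν i) ∧ IsEigenSeq (ContinuousLinearMap.adjoint V ∘L V) (fun i => ν i ^ 2)

/-- `∑ᵢ e^{−l/νᵢ²}`, the sum being taken over the indices with `νᵢ ≠ 0`. -/
def expSum (ν : ℕ → ℝ) (l : ℝ) : ℝ≥0∞ :=
  ∑' i, if ν i = 0 then 0 else ENNReal.ofReal (Real.exp (-(l / ν i ^ 2)))

/-- `λ*(V) < ∞`: `V` is compact (automatic here) and `∑ᵢ e^{−l/νᵢ²} < ∞` for some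
`l > 0`, where `{νᵢ}` are the singular values of `V`. -/
def LamStarFin (V : E →L[ℂ] F) : Prop :=
  ∃ ν : ℕ → ℝ, IsSingularValues V ν ∧ ∃ l : ℝ, 0 < l ∧ expSum ν l ≠ ∞

/-- `λ*(√S) < ∞` for a positive operator `S` (the singular values of `√S` are the
square roots of the eigenvalues of `S`). -/
def LamStarSqrtFin (S : E →L[ℂ] E) : Prop :=
  ∃ ν : ℕ → ℝ, (∀ i, 0 ≤ ν i) ∧ IsEigenSeq S (fun i => ν i ^ 2) ∧
    ∃ l : ℝ, 0 < l ∧ expSum ν l ≠ ∞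

/-- The value `λ*` associated to a sequence `ν` of singular values: the unique solution
of `∑ᵢ e^{−λ/νᵢ²} = 1` if it exists, and `inf{λ > 0 | ∑ᵢ e^{−λ/νᵢ²} < ∞}` otherwise. -/
def lamStarOf (ν : ℕ → ℝ) : ℝ≥0∞ :=
  if h : ∃ l : ℝ, expSum ν l = 1 then ENNReal.ofReal h.choose
  else ⨅ (l : ℝ) (_ : 0 < l ∧ expSum ν l ≠ ∞), ENNReal.ofReal l

/-- The parameter `λ*(V) ∈ [0,∞]` of a bounded operator `V`. -/
def lamStar (V : E →L[ℂ] F) : ℝ≥0∞ :=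
  if h : ∃ ν : ℕ → ℝ, IsSingularValues V ν then lamStarOf h.choose else ∞

/-- `rank A ≤ k`. -/
def rankLE (A : E →L[ℂ] E) (k : ℕ) : Prop :=
  Module.rank ℂ (LinearMap.range (A : E →ₗ[ℂ] E)) ≤ k

/-- The set `𝔗₊ᵏ(E)` of positive (trace-class) operators of rank at most `k`. -/
def rankCone (E : Type*) [NormedAddCommGroup E] [InnerProductSpace ℂ E] [CompleteSpace E]
    (k : ℕ) : Set (E →L[ℂ] E) := {A | A.IsPositive ∧ rankLE A k}

/-- A decomposition of `A` into a countable convex combination of positive operators of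
rank at most `k`. -/
structure Decomp (k : ℕ) (A : E →L[ℂ] E) where
  π : ℕ → ℝ
  op : ℕ → (E →L[ℂ] E)
  π_nonneg : ∀ i, 0 ≤ π i
  π_sum : HasSum π 1
  op_pos : ∀ i, (op i).IsPositive
  op_rank : ∀ i, rankLE (op i) k
  sum_eq : HasSum (fun i => π i • op i) A

/-- The `k`-order approximator `H_Φᵏ` of the output entropy of `Φ`. -/
def kApprox (Φf : (E →L[ℂ] E) → (F →L[ℂ] F)) (k : ℕ) (A : E →L[ℂ] E) : ℝ≥0∞ :=
  ⨆ d : Decomp k A, ∑' i, ENNReal.ofReal (d.π i) * qEntropy (Φf (d.op i))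

/-- The set of pure states (extreme points of `𝔖(E)`). -/
def pureStates (E : Type*) [NormedAddCommGroup E] [InnerProductSpace ℂ E]
    [CompleteSpace E] : Set (E →L[ℂ] E) := {A | ∃ x : E, ‖x‖ = 1 ∧ A = rankOne x}

end Defs2

section Tensor

variable (E F G : Type*)
variable [NormedAddCommGroup E] [InnerProductSpace ℂ E] [CompleteSpace E]
variable [NormedAddCommGroup F] [InnerProductSpace ℂ F] [CompleteSpace F]
variable [NormedAddCommGroup G] [InnerProductSpace ℂ G] [CompleteSpace G]

/-- A realization of `G` as the Hilbert tensor product `E ⊗ F`, together with the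
tensor product of (bounded) operators. -/
structure TensorData where
  tmul : E → F → G
  add_left : ∀ x y z, tmul (x + y) z = tmul x z + tmul y z
  add_right : ∀ x y z, tmul x (y + z) = tmul x y + tmul x z
  smul_left : ∀ (c : ℂ) x y, tmul (c • x) y = c • tmul x y
  smul_right : ∀ (c : ℂ) x y, tmul x (c • y) = c • tmul x y
  inner_tmul : ∀ x x' y y',
    (inner ℂ (tmul x y) (tmul x' y') : ℂ) = (inner ℂ x x' : ℂ) * (inner ℂ y y' : ℂ)
  dense_span : Dense ((Submodule.span ℂ {z | ∃ x y, z = tmul x y} : Submodule ℂ G) : Set G)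
  omul : (E →L[ℂ] E) → (F →L[ℂ] F) → (G →L[ℂ] G)
  omul_tmul : ∀ A B x y, omul A B (tmul x y) = tmul (A x) (B y)

end Tensor

section Compactness

variable {E : Type*} [NormedAddCommGroup E] [InnerProductSpace ℂ E] [CompleteSpace E]

/-- (Sequential) compactness of a set of operators with respect to the trace-norm
distance. -/
def TNCompact (𝒜 : Set (E →L[ℂ] E)) : Prop :=
  ∀ A : ℕ → (E →L[ℂ] E), (∀ n, A n ∈ 𝒜) →
    ∃ B ∈ 𝒜, ∃ φ : ℕ → ℕ, StrictMono φ ∧ TendstoTN (A ∘ φ) B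

end Compactness

section Classical

/-- The summand `x log (t / x)` of the extended classical entropy of a family with sum `t`. -/
def entTerm (t x : ℝ) : ℝ := x * (Real.log t - Real.log x)

/-- The entropy summand truncated by a linear function of slope `L`. -/
def truncTerm (L t x : ℝ) : ℝ := min (entTerm t x) (L * x)

theorem entTerm_le_sub {u x : ℝ} (hu : 0 < u) (hx : 0 ≤ x) : entTerm u x ≤ u - x := by
  unfold entTerm
  rcases hx.eq_or_lt with rfl | hx
  · simpa using hu.le
  · have h := Real.log_le_sub_one_of_pos (div_pos hu hx)
    rw [Real.log_div hu.ne' hx.ne'] at h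
    have h2 := mul_le_mul_of_nonneg_left h hx.le
    have h3 : x * (u / x - 1) = u - x := by field_simp
    linarith

@[simp] theorem entTerm_zero_right (t : ℝ) : entTerm t 0 = 0 := by simp [entTerm]

theorem entTerm_nonneg {t x : ℝ} (hx : 0 ≤ x) (hxt : x ≤ t) : 0 ≤ entTerm t x := by
  rcases hx.eq_or_lt with rfl | hx
  · simp
  · exact mul_nonneg hx.le (sub_nonneg.2 (Real.log_le_log hx hxt))

theorem entTerm_change_left (t t' x : ℝ) :
    entTerm t' x = entTerm t x + x * (Real.log t' - Real.log t) := by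
  unfold entTerm; ring

/-- The tangent line inequality for `entTerm t`, taken at the point `x`. -/
theorem entTerm_add_le_tangent {t x y : ℝ} (hx : 0 < x) (hy : 0 ≤ y) :
    entTerm t y + y ≤ y * (Real.log t - Real.log x) + x := by
  have h := entTerm_le_sub hx hy
  rw [entTerm_change_left x t y]
  nlinarith

theorem entTerm_superadd {t t' x y : ℝ} (hx : 0 ≤ x) (hxt : x ≤ t) (hy : 0 ≤ y) (hyt : y ≤ t') :
    entTerm t x + entTerm t' y ≤ entTerm (t + t') (x + y) := by
  rcases hx.eq_or_lt with rfl | hx0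
  · rcases hy.eq_or_lt with rfl | hy0
    · simp
    · have : Real.log t' ≤ Real.log (t + t') := Real.log_le_log (by linarith) (by linarith)
      rw [entTerm_zero_right, zero_add, zero_add]
      unfold entTerm
      gcongr
  · rcases hy.eq_or_lt with rfl | hy0
    · have : Real.log t ≤ Real.log (t + t') := Real.log_le_log (by linarith) (by linarith)
      rw [entTerm_zero_right, add_zero, add_zero]
      unfold entTerm
      gcongr
    · have ht : 0 < t := by linarith
      have ht' : 0 < t' := by linarith
      have hp : 0 < (x + y) / (t + t') := by positivity
      have h1 := entTerm_le_sub (mul_pos hp ht) hx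
      have h2 := entTerm_le_sub (mul_pos hp ht') hy
      have h3 : (x + y) / (t + t') * t + (x + y) / (t + t') * t' = x + y := by field_simp
      unfold entTerm at *
      rw [Real.log_mul hp.ne' ht.ne', Real.log_div (by positivity) (by positivity)] at h1
      rw [Real.log_mul hp.ne' ht'.ne', Real.log_div (by positivity) (by positivity)] at h2
      nlinarith

theorem truncTerm_le_entTerm (L t x : ℝ) : truncTerm L t x ≤ entTerm t x := min_le_left _ _

theorem truncTerm_nonneg {L t x : ℝ} (hL : 0 ≤ L) (hx : 0 ≤ x) (hxt : x ≤ t) :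
    0 ≤ truncTerm L t x :=
  le_min (entTerm_nonneg hx hxt) (mul_nonneg hL hx)

/-- Lipschitz estimate for the truncated summand. -/
theorem truncTerm_le_add {L t x y : ℝ} (hL : 0 ≤ L) (hx : 0 ≤ x) (hxt : x ≤ t)
    (hy : 0 ≤ y) : truncTerm L t y ≤ truncTerm L t x + (L + 1) * |x - y| := by
  have habs := abs_nonneg (x - y)
  rcases hx.eq_or_lt with rfl | hx0
  · have h1 : truncTerm L t y ≤ L * y := min_le_right _ _
    have h2 : truncTerm L t 0 = 0 := by simp [truncTerm]
    rw [h2, zero_sub, abs_neg, abs_of_nonneg hy]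
    nlinarith
  rcases le_total y x with hyx | hxy
  · rw [abs_of_nonneg (sub_nonneg.2 hyx)]
    have h0 : 0 ≤ Real.log t - Real.log x := sub_nonneg.2 (Real.log_le_log hx0 hxt)
    have h1 := entTerm_add_le_tangent (t := t) hx0 hy
    unfold truncTerm
    rw [← min_add_add_right]
    refine min_le_min ?_ ?_
    · have : y * (Real.log t - Real.log x) ≤ x * (Real.log t - Real.log x) := by gcongr
      have h3 : entTerm t x = x * (Real.log t - Real.log x) := rfl
      nlinarith
    · nlinarith
  · have hy0 : 0 < y := by linarith
    rw [abs_sub_comm, abs_of_nonneg (sub_nonneg.2 hxy)]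
    have hlog : Real.log x ≤ Real.log y := Real.log_le_log hx0 hxy
    unfold truncTerm
    rcases le_total (Real.log t - Real.log x) L with h | h
    · have : entTerm t x ≤ L * x := by unfold entTerm; nlinarith
      rw [min_eq_left this]
      refine (min_le_left _ _).trans ?_
      unfold entTerm
      nlinarith [mul_nonneg hy (sub_nonneg.2 hlog), mul_nonneg (sub_nonneg.2 hxy) (sub_nonneg.2 h)]
    · have : L * x ≤ entTerm t x := by unfold entTerm; nlinarith
      rw [min_eq_right this]
      refine (min_le_right _ _).trans ?_
      nlinarith

theorem entTerm_le_two_mul_sqrt {t x : ℝ} (hx : 0 ≤ x) (hxt : x ≤ t) :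
    entTerm t x ≤ 2 * √(t * x) := by
  rcases hx.eq_or_lt with rfl | hx0
  · simp
  have ht : 0 < t := by linarith
  have h1 := Real.log_le_sub_one_of_pos (Real.sqrt_pos.2 (div_pos ht hx0))
  rw [Real.log_sqrt (by positivity), Real.log_div ht.ne' hx0.ne'] at h1
  have h2 : x * √(t / x) = √(t * x) := by
    rw [← Real.sqrt_sq hx, ← Real.sqrt_mul (sq_nonneg x), Real.sqrt_sq hx]
    congr 1
    field_simp
  have h3 := mul_le_mul_of_nonneg_left h1 hx
  unfold entTerm
  nlinarith

variable {ι : Type*}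

theorem clEntropy_eq {x : ι → ℝ} {t : ℝ} (hx : ∀ i, 0 ≤ x i) (hs : HasSum x t) :
    clEntropy x = ∑' i, ENNReal.ofReal (entTerm t (x i)) := by
  have ht : 0 ≤ t := hs.nonneg hx
  unfold clEntropy
  rw [hs.tsum_eq, ← ENNReal.tsum_mul_left]
  refine tsum_congr fun i => ?_
  rw [← ENNReal.ofReal_mul ht]
  congr 1
  have hit : x i ≤ t := le_hasSum hs i fun j _ => hx j
  rcases ht.eq_or_lt with rfl | ht
  · have : x i = 0 := le_antisymm hit (hx i)
    simp [this]
  rcases (hx i).eq_or_lt with h | h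
  · simp [← h]
  · unfold Real.negMulLog entTerm
    rw [Real.log_div h.ne' ht.ne']
    field_simp
    ring

theorem clEntropy_superadd {x y : ι → ℝ} (hx : ∀ i, 0 ≤ x i) (hy : ∀ i, 0 ≤ y i)
    (hxs : Summable x) (hys : Summable y) :
    clEntropy x + clEntropy y ≤ clEntropy fun i => x i + y i := by
  obtain ⟨t, ht⟩ := hxs
  obtain ⟨t', ht'⟩ := hys
  rw [clEntropy_eq hx ht, clEntropy_eq hy ht',
    clEntropy_eq (fun i => add_nonneg (hx i) (hy i)) (ht.add ht'), ← ENNReal.tsum_add]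
  refine ENNReal.tsum_le_tsum fun i => ?_
  have h1 : x i ≤ t := le_hasSum ht i fun j _ => hx j
  have h2 : y i ≤ t' := le_hasSum ht' i fun j _ => hy j
  rw [← ENNReal.ofReal_add (entTerm_nonneg (hx i) h1) (entTerm_nonneg (hy i) h2)]
  exact ENNReal.ofReal_le_ofReal (entTerm_superadd (hx i) h1 (hy i) h2)

theorem clEntropy_mono {x y : ι → ℝ} (hx : ∀ i, 0 ≤ x i) (hxy : ∀ i, x i ≤ y i)
    (hys : Summable y) : clEntropy x ≤ clEntropy y := by
  have hxs : Summable x := .of_nonneg_of_le hx hxy hys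
  have h := clEntropy_superadd hx (fun i => sub_nonneg.2 (hxy i)) hxs (hys.sub hxs)
  simp only [add_sub_cancel] at h
  exact le_self_add.trans h

theorem clEntropy_const_mul {x : ι → ℝ} {c : ℝ} (hc : 0 < c) :
    clEntropy (fun i => c * x i) = ENNReal.ofReal c * clEntropy x := by
  unfold clEntropy
  rw [tsum_mul_left, ENNReal.ofReal_mul hc.le, mul_assoc]
  simp only [mul_div_mul_left _ _ hc.ne']

/-- Chain rule: the entropy of a doubly indexed family is the entropy of the family of the
partial sums plus the entropies of the subfamilies. -/
theorem clEntropy_sigma {κ : ι → Type*} {x : (i : ι) → κ i → ℝ} {t : ι → ℝ} {T : ℝ}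
    (hx : ∀ i k, 0 ≤ x i k) (hs : ∀ i, HasSum (x i) (t i)) (ht : HasSum t T) :
    clEntropy (fun p : Σ i, κ i => x p.1 p.2) = clEntropy t + ∑' i, clEntropy (x i) := by
  have ht0 : ∀ i, 0 ≤ t i := fun i => (hs i).nonneg (hx i)
  have hsum : HasSum (fun p : Σ i, κ i => x p.1 p.2) T := by
    have hS : Summable (fun p : Σ i, κ i => x p.1 p.2) := by
      rw [summable_sigma_of_nonneg fun p => hx p.1 p.2]
      refine ⟨fun i => (hs i).summable, ?_⟩
      simpa only [(hs _).tsum_eq] using ht.summable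
    have := hS.hasSum.sigma hs
    rw [ht.unique this]
    exact hS.hasSum
  rw [clEntropy_eq (x := fun p : Σ i, κ i => x p.1 p.2) (fun p => hx p.1 p.2) hsum,
    clEntropy_eq ht0 ht, ENNReal.tsum_sigma',
    ← ENNReal.tsum_add]
  refine tsum_congr fun i => ?_
  rw [clEntropy_eq (hx i) (hs i)]
  have hiT : t i ≤ T := le_hasSum ht i fun j _ => ht0 j
  rcases (ht0 i).eq_or_lt with h0 | h0
  · have hz : ∀ k, x i k = 0 := fun k =>
      le_antisymm (h0 ▸ le_hasSum (hs i) k fun j _ => hx i j) (hx i k)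
    simp [hz, ← h0]
  have hlog : 0 ≤ Real.log T - Real.log (t i) := sub_nonneg.2 (Real.log_le_log h0 hiT)
  have h1 : ENNReal.ofReal (entTerm T (t i)) =
      ∑' k, ENNReal.ofReal (x i k * (Real.log T - Real.log (t i))) := by
    have hh := (hs i).mul_right (Real.log T - Real.log (t i))
    rw [← ENNReal.ofReal_tsum_of_nonneg (fun k => mul_nonneg (hx i k) hlog) hh.summable,
      hh.tsum_eq]
    rfl
  rw [h1, ← ENNReal.tsum_add]
  refine tsum_congr fun k => ?_
  rw [← ENNReal.ofReal_add (mul_nonneg (hx i k) hlog)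
    (entTerm_nonneg (hx i k) (le_hasSum (hs i) k fun j _ => hx i j)),
    entTerm_change_left (t i) T, add_comm]

/-- Jensen's inequality for the truncated entropy summand with substochastic weights. -/
theorem tsum_mul_truncTerm_le {w : ι → ℝ≥0∞} {l : ι → ℝ} {x t L : ℝ} (hl : ∀ j, 0 ≤ l j)
    (hlt : ∀ j, l j ≤ t) (hx : 0 ≤ x) (hxt : x ≤ t) (hL : 0 ≤ L) (hw : ∑' j, w j ≤ 1)
    (hsum : ∑' j, w j * ENNReal.ofReal (l j) = ENNReal.ofReal x) :
    ∑' j, w j * ENNReal.ofReal (truncTerm L t (l j)) ≤ ENNReal.ofReal (truncTerm L t x) := by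
  have hmin : ENNReal.ofReal (truncTerm L t x) =
      min (ENNReal.ofReal (entTerm t x)) (ENNReal.ofReal (L * x)) :=
    ENNReal.ofReal_mono.map_min
  have hlin : ∑' j, w j * ENNReal.ofReal (truncTerm L t (l j)) ≤ ENNReal.ofReal (L * x) := by
    rw [ENNReal.ofReal_mul hL, ← hsum, ← ENNReal.tsum_mul_left]
    refine ENNReal.tsum_le_tsum fun j => ?_
    rw [mul_left_comm, ← ENNReal.ofReal_mul hL]
    gcongr
    exact min_le_right _ _
  rw [hmin]
  refine le_min ?_ hlin
  rcases hx.eq_or_lt with rfl | hx0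
  · simpa using hlin
  have hlog : 0 ≤ Real.log t - Real.log x := sub_nonneg.2 (Real.log_le_log hx0 hxt)
  have key : ∀ j, w j * ENNReal.ofReal (truncTerm L t (l j)) + w j * ENNReal.ofReal (l j) ≤
      w j * ENNReal.ofReal (l j) * ENNReal.ofReal (Real.log t - Real.log x) +
        w j * ENNReal.ofReal x := by
    intro j
    rw [← mul_add, mul_assoc, ← ENNReal.ofReal_mul (hl j), ← mul_add,
      ← ENNReal.ofReal_add (mul_nonneg (hl j) hlog) hx]
    gcongr
    rw [← ENNReal.ofReal_add (truncTerm_nonneg hL (hl j) (hlt j)) (hl j)]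
    refine ENNReal.ofReal_le_ofReal ?_
    have := entTerm_add_le_tangent (t := t) hx0 (hl j)
    linarith [truncTerm_le_entTerm L t (l j)]
  have hsumkey := ENNReal.tsum_le_tsum key
  rw [ENNReal.tsum_add, ENNReal.tsum_add, ENNReal.tsum_mul_right, ENNReal.tsum_mul_right,
    hsum, ← ENNReal.ofReal_mul hx] at hsumkey
  refine (ENNReal.add_le_add_iff_right (ENNReal.ofReal_ne_top (r := x))).1 (hsumkey.trans ?_)
  unfold entTerm
  gcongr
  exact mul_le_of_le_one_left zero_le hw

end Classical

set_option linter.unusedSectionVars false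

section Trace

variable {E : Type*} [NormedAddCommGroup E] [InnerProductSpace ℂ E] [CompleteSpace E]

theorem IsONB.exists_hilbertBasis {s : Set E} (hs : IsONB s) :
    ∃ b : HilbertBasis s ℂ E, ⇑b = ((↑) : s → E) := by
  refine ⟨HilbertBasis.mk hs.1 ?_, HilbertBasis.coe_mk _ _⟩
  rw [Subtype.range_coe, Submodule.dense_iff_topologicalClosure_eq_top.1 hs.2]

theorem IsONB.tsum_norm_inner_sq {s : Set E} (hs : IsONB s) (y : E) :
    ∑' v : s, ENNReal.ofReal (‖(inner ℂ (v : E) y : ℂ)‖ ^ 2) = ENNReal.ofReal (‖y‖ ^ 2) := by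
  obtain ⟨b, hb⟩ := hs.exists_hilbertBasis
  have h := Complex.hasSum_re (b.hasSum_inner_mul_inner y y)
  have h1 : ∀ i, ((inner ℂ y (b i) : ℂ) * inner ℂ (b i) y).re =
      ‖(inner ℂ (i : E) y : ℂ)‖ ^ 2 := by
    intro i
    rw [← inner_conj_symm y (b i), Complex.conj_mul', hb]
    norm_cast
  have h2 : (inner ℂ y y : ℂ).re = ‖y‖ ^ 2 := by
    simpa using inner_self_eq_norm_sq (𝕜 := ℂ) y
  simp only [h1, h2] at h
  rw [← ENNReal.ofReal_tsum_of_nonneg (fun _ => by positivity) h.summable, h.tsum_eq]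

theorem qf_add (A B : E →L[ℂ] E) (x : E) : qf (A + B) x = qf A x + qf B x := by
  simp [qf]

theorem qf_sub (A B : E →L[ℂ] E) (x : E) : qf (A - B) x = qf A x - qf B x := by
  simp [qf]

theorem qf_sum {ι : Type*} (s : Finset ι) (B : ι → E →L[ℂ] E) (x : E) :
    qf (∑ i ∈ s, B i) x = ∑ i ∈ s, qf (B i) x := by
  simp [qf]

theorem qf_smul (c : ℝ) (A : E →L[ℂ] E) (x : E) : qf ((c : ℂ) • A) x = c * qf A x := by
  simp [qf]

theorem qf_nonneg {A : E →L[ℂ] E} (hA : A.IsPositive) (x : E) : 0 ≤ qf A x :=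
  hA.re_inner_nonneg_right x

theorem qf_rankOne (x y : E) : qf (rankOne x) y = ‖(inner ℂ x y : ℂ)‖ ^ 2 := by
  have h : (inner ℂ y (rankOne x y) : ℂ) = inner ℂ x y * (starRingEnd ℂ) (inner ℂ x y) := by
    simp [rankOne]
  rw [qf, h, Complex.mul_conj']
  norm_cast

theorem isPositive_of_qf_nonneg {A : E →L[ℂ] E} (hA : IsSelfAdjoint A) (h : ∀ x, 0 ≤ qf A x) :
    A.IsPositive := by
  rw [ContinuousLinearMap.isPositive_def']
  refine ⟨hA, fun x => ?_⟩
  have := h x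
  rwa [qf, ← inner_conj_symm, Complex.conj_re] at this

theorem isPositive_rankOne (x : E) : (rankOne x).IsPositive := by
  rw [ContinuousLinearMap.isPositive_iff_complex]
  intro y
  have h : (inner ℂ (rankOne x y) y : ℂ) = ((‖(inner ℂ x y : ℂ)‖ ^ 2 : ℝ) : ℂ) := by
    simp only [rankOne, ContinuousLinearMap.smulRight_apply, innerSL_apply_apply, inner_smul_left]
    rw [Complex.conj_mul']
    norm_cast
  rw [h]
  exact ⟨rfl, sq_nonneg ‖(inner ℂ x y : ℂ)‖⟩

/-- Every positive operator has a positive square root. -/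
theorem exists_positive_sqrt {A : E →L[ℂ] E} (hA : A.IsPositive) :
    ∃ R : E →L[ℂ] E, R.IsPositive ∧ ∀ x y, (inner ℂ x (A y) : ℂ) = inner ℂ (R x) (R y) := by
  have h0 : 0 ≤ A := (ContinuousLinearMap.nonneg_iff_isPositive A).2 hA
  have hR := (ContinuousLinearMap.nonneg_iff_isPositive _).1 (CFC.sqrt_nonneg A)
  refine ⟨CFC.sqrt A, hR, fun x y => ?_⟩
  rw [hR.inner_left_eq_inner_right]
  conv_lhs => rw [← CFC.sqrt_mul_sqrt_self A h0]
  rfl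

theorem qf_eq_norm_sq {A R : E →L[ℂ] E}
    (hR : ∀ x y, (inner ℂ x (A y) : ℂ) = inner ℂ (R x) (R y)) (x : E) : qf A x = ‖R x‖ ^ 2 := by
  rw [qf, hR]
  simpa using inner_self_eq_norm_sq (𝕜 := ℂ) (R x)

theorem sum_le_traceENN {n : ℕ} {e : Fin n → E} (he : Orthonormal ℂ e) (A : E →L[ℂ] E) :
    ∑ i, ENNReal.ofReal (qf A (e i)) ≤ traceENN A :=
  le_iSup_of_le n <| le_iSup_of_le e <| le_iSup_of_le he le_rfl

/-- Summation over an orthonormal family indexed by an arbitrary finite set. -/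
theorem exists_fin_orthonormal {ι : Type*} {v : ι → E} (hv : Orthonormal ℂ v) (T : Finset ι) :
    ∃ e : Fin T.card → E, Orthonormal ℂ e ∧
      ∀ f : E → ℝ≥0∞, ∑ i, f (e i) = ∑ i ∈ T, f (v i) := by
  refine ⟨fun i => v (T.equivFin.symm i), ?_, fun f => ?_⟩
  · exact hv.comp _ (Subtype.val_injective.comp T.equivFin.symm.injective)
  · rw [← Finset.sum_coe_sort T fun i => f (v i)]
    exact Equiv.sum_comp T.equivFin.symm fun i : T => f (v i)

theorem traceENN_eq {A : E →L[ℂ] E} (hA : A.IsPositive) {s : Set E} (hs : IsONB s) :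
    traceENN A = ∑' v : s, ENNReal.ofReal (qf A v) := by
  apply le_antisymm
  · obtain ⟨R, hRpos, hR⟩ := exists_positive_sqrt hA
    refine iSup_le fun n => iSup_le fun e => iSup_le fun he => ?_
    calc ∑ i, ENNReal.ofReal (qf A (e i))
        = ∑ i, ∑' v : s, ENNReal.ofReal (‖(inner ℂ (e i) (R v) : ℂ)‖ ^ 2) := by
          refine Finset.sum_congr rfl fun i _ => ?_
          rw [qf_eq_norm_sq hR, ← hs.tsum_norm_inner_sq]
          refine tsum_congr fun v => ?_
          rw [← hRpos.inner_left_eq_inner_right, norm_inner_symm]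
      _ = ∑' v : s, ∑ i, ENNReal.ofReal (‖(inner ℂ (e i) (R v) : ℂ)‖ ^ 2) :=
          (Summable.tsum_finsetSum fun _ _ => ENNReal.summable).symm
      _ ≤ ∑' v : s, ENNReal.ofReal (qf A v) := by
          refine ENNReal.tsum_le_tsum fun v => ?_
          rw [← ENNReal.ofReal_sum_of_nonneg fun _ _ => by positivity, qf_eq_norm_sq hR]
          exact ENNReal.ofReal_le_ofReal (he.sum_inner_products_le (R v))
  · rw [ENNReal.tsum_eq_iSup_sum]
    refine iSup_le fun T => ?_
    obtain ⟨e, he, hsum⟩ := exists_fin_orthonormal hs.1 T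
    rw [← hsum fun x => ENNReal.ofReal (qf A x)]
    exact sum_le_traceENN he A

theorem traceENN_le_traceNorm (A : E →L[ℂ] E) : traceENN A ≤ traceNorm A := by
  refine iSup_le fun n => iSup_le fun e => iSup_le fun he => ?_
  refine le_iSup_of_le n <| le_iSup_of_le e <| le_iSup_of_le e <| le_iSup_of_le he <|
    le_iSup_of_le he ?_
  gcongr
  exact Complex.re_le_norm _

theorem traceNorm_eq_traceENN {A : E →L[ℂ] E} (hA : A.IsPositive) :
    traceNorm A = traceENN A := by
  refine le_antisymm ?_ (traceENN_le_traceNorm A)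
  obtain ⟨R, -, hR⟩ := exists_positive_sqrt hA
  refine iSup_le fun n => iSup_le fun e => iSup_le fun f => iSup_le fun he => iSup_le fun hf => ?_
  have h1 : ∀ i, ENNReal.ofReal ‖(inner ℂ (e i) (A (f i)) : ℂ)‖ ≤
      2⁻¹ * ENNReal.ofReal (qf A (e i)) + 2⁻¹ * ENNReal.ofReal (qf A (f i)) := by
    intro i
    have h2 : (2⁻¹ : ℝ≥0∞) = ENNReal.ofReal 2⁻¹ := by
      rw [ENNReal.ofReal_inv_of_pos two_pos]; simp
    rw [h2, ← ENNReal.ofReal_mul (by norm_num), ← ENNReal.ofReal_mul (by norm_num),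
      ← ENNReal.ofReal_add (mul_nonneg (by norm_num) (qf_nonneg hA _))
        (mul_nonneg (by norm_num) (qf_nonneg hA _)), qf_eq_norm_sq hR, qf_eq_norm_sq hR, hR]
    refine ENNReal.ofReal_le_ofReal ((norm_inner_le_norm _ _).trans ?_)
    nlinarith [sq_nonneg (‖R (e i)‖ - ‖R (f i)‖)]
  calc ∑ i, ENNReal.ofReal ‖(inner ℂ (e i) (A (f i)) : ℂ)‖
      ≤ ∑ i, (2⁻¹ * ENNReal.ofReal (qf A (e i)) + 2⁻¹ * ENNReal.ofReal (qf A (f i))) :=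
        Finset.sum_le_sum fun i _ => h1 i
    _ = 2⁻¹ * ∑ i, ENNReal.ofReal (qf A (e i)) + 2⁻¹ * ∑ i, ENNReal.ofReal (qf A (f i)) := by
        rw [Finset.sum_add_distrib, Finset.mul_sum, Finset.mul_sum]
    _ ≤ 2⁻¹ * traceENN A + 2⁻¹ * traceENN A := by
        gcongr
        · exact sum_le_traceENN he A
        · exact sum_le_traceENN hf A
    _ = traceENN A := by rw [← add_mul, ENNReal.inv_two_add_inv_two, one_mul]

theorem isTC_iff {A : E →L[ℂ] E} (hA : A.IsPositive) : IsTC A ↔ traceENN A ≠ ∞ := by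
  rw [IsTC, traceNorm_eq_traceENN hA]

theorem norm_inner_le_traceNorm (A : E →L[ℂ] E) {x y : E} (hx : ‖x‖ = 1) (hy : ‖y‖ = 1) :
    ENNReal.ofReal ‖(inner ℂ x (A y) : ℂ)‖ ≤ traceNorm A := by
  have h : ∀ z : E, ‖z‖ = 1 → Orthonormal ℂ (fun _ : Fin 1 => z) := fun z hz =>
    ⟨fun _ => hz, fun i j hij => absurd (Subsingleton.elim i j) hij⟩
  refine le_iSup_of_le 1 <| le_iSup_of_le _ <| le_iSup_of_le _ <| le_iSup_of_le (h x hx) <|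
    le_iSup_of_le (h y hy) ?_
  simp

theorem ofReal_norm_le_traceENN {A : E →L[ℂ] E} (hA : A.IsPositive) :
    ENNReal.ofReal ‖A‖ ≤ traceENN A := by
  rcases eq_or_ne (traceENN A) ∞ with htop | htop
  · simp [htop]
  rw [ENNReal.ofReal_le_iff_le_toReal htop]
  refine ContinuousLinearMap.opNorm_le_of_unit_norm ENNReal.toReal_nonneg fun y hy => ?_
  rcases eq_or_ne (A y) 0 with h0 | h0
  · simp [h0]
  have hn : 0 < ‖A y‖ := norm_pos_iff.2 h0
  have hx : ‖((‖A y‖⁻¹ : ℝ) : ℂ) • A y‖ = 1 := by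
    rw [norm_smul]; simp [hn.ne']
  have h := norm_inner_le_traceNorm A hx hy
  rw [traceNorm_eq_traceENN hA, ENNReal.ofReal_le_iff_le_toReal htop] at h
  refine le_trans (le_of_eq ?_) h
  rw [inner_smul_left, norm_mul, inner_self_eq_norm_sq_to_K]
  simp
  field_simp

theorem qf_le_traceENN {A : E →L[ℂ] E} (hA : A.IsPositive) (y : E) :
    ENNReal.ofReal (qf A y) ≤ ENNReal.ofReal (‖y‖ ^ 2) * traceENN A := by
  refine le_trans ?_ (mul_le_mul_right (ofReal_norm_le_traceENN hA) _)
  rw [← ENNReal.ofReal_mul (by positivity)]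
  refine ENNReal.ofReal_le_ofReal ?_
  calc qf A y ≤ ‖(inner ℂ y (A y) : ℂ)‖ := Complex.re_le_norm _
    _ ≤ ‖y‖ * ‖A y‖ := norm_inner_le_norm _ _
    _ ≤ ‖y‖ * (‖A‖ * ‖y‖) := by gcongr; exact A.le_opNorm y
    _ = ‖y‖ ^ 2 * ‖A‖ := by ring

theorem traceENN_add {A B : E →L[ℂ] E} (hA : A.IsPositive) (hB : B.IsPositive) :
    traceENN (A + B) = traceENN A + traceENN B := by
  obtain ⟨s, hs⟩ := exists_isONB E
  rw [traceENN_eq hA hs, traceENN_eq hB hs, traceENN_eq (hA.add hB) hs, ← ENNReal.tsum_add]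
  refine tsum_congr fun v => ?_
  rw [qf_add, ENNReal.ofReal_add (qf_nonneg hA _) (qf_nonneg hB _)]

theorem traceENN_rankOne (x : E) : traceENN (rankOne x) = ENNReal.ofReal (‖x‖ ^ 2) := by
  obtain ⟨s, hs⟩ := exists_isONB E
  rw [traceENN_eq (isPositive_rankOne x) hs, ← hs.tsum_norm_inner_sq]
  refine tsum_congr fun v => ?_
  rw [qf_rankOne, norm_inner_symm]

theorem hasSum_qf {A : E →L[ℂ] E} (hA : A ∈ posTC E) {s : Set E} (hs : IsONB s) :
    HasSum (fun v : s => qf A v) (traceENN A).toReal := by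
  have h := (isTC_iff hA.1).1 hA.2
  rw [traceENN_eq hA.1 hs] at h ⊢
  have := ENNReal.hasSum_toReal h
  rw [← ENNReal.tsum_toReal_eq fun v => ENNReal.ofReal_ne_top] at this
  simpa only [ENNReal.toReal_ofReal (qf_nonneg hA.1 _)] using this

theorem traceNorm_add_le (A B : E →L[ℂ] E) : traceNorm (A + B) ≤ traceNorm A + traceNorm B := by
  refine iSup_le fun n => iSup_le fun e => iSup_le fun f => iSup_le fun he => iSup_le fun hf => ?_
  have hle : ∀ D : E →L[ℂ] E,
      ∑ i, ENNReal.ofReal ‖(inner ℂ (e i) (D (f i)) : ℂ)‖ ≤ traceNorm D := fun D =>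
    le_iSup_of_le n <| le_iSup_of_le e <| le_iSup_of_le f <| le_iSup_of_le he <|
      le_iSup_of_le hf le_rfl
  refine le_trans ?_ (add_le_add (hle A) (hle B))
  rw [← Finset.sum_add_distrib]
  refine Finset.sum_le_sum fun i _ => ?_
  rw [← ENNReal.ofReal_add (norm_nonneg _) (norm_nonneg _)]
  refine ENNReal.ofReal_le_ofReal ?_
  rw [add_apply, inner_add_right]
  exact norm_add_le _ _

theorem traceNorm_neg (A : E →L[ℂ] E) : traceNorm (-A) = traceNorm A := by
  simp [traceNorm]

theorem tsum_abs_qf_sub_le (A B : E →L[ℂ] E) {s : Set E} (hs : IsONB s) :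
    ∑' v : s, ENNReal.ofReal |qf A v - qf B v| ≤ traceNorm (A - B) := by
  rw [ENNReal.tsum_eq_iSup_sum]
  refine iSup_le fun T => ?_
  obtain ⟨e, he, hsum⟩ := exists_fin_orthonormal hs.1 T
  rw [← hsum fun x => ENNReal.ofReal |qf A x - qf B x|]
  refine le_iSup_of_le T.card <| le_iSup_of_le e <| le_iSup_of_le e <| le_iSup_of_le he <|
    le_iSup_of_le he ?_
  gcongr
  rw [← qf_sub]
  exact Complex.abs_re_le_norm _

end Trace

section WeakSums

variable {E F : Type*} [NormedAddCommGroup E] [InnerProductSpace ℂ E] [CompleteSpace E]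
variable [NormedAddCommGroup F] [InnerProductSpace ℂ F] [CompleteSpace F]
variable {ι : Type*}

/-- The positive operator `A` is the weak sum of the positive operators `B i`. -/
def WSum (B : ι → E →L[ℂ] E) (A : E →L[ℂ] E) : Prop :=
  ∀ y, ∑' i, ENNReal.ofReal (qf (B i) y) = ENNReal.ofReal (qf A y)

theorem WSum.traceENN_eq {B : ι → E →L[ℂ] E} {A : E →L[ℂ] E} (h : WSum B A)
    (hB : ∀ i, (B i).IsPositive) (hA : A.IsPositive) :
    ∑' i, traceENN (B i) = traceENN A := by
  obtain ⟨s, hs⟩ := exists_isONB E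
  simp only [fun i => QIT.traceENN_eq (hB i) hs]
  rw [QIT.traceENN_eq hA hs, ENNReal.tsum_comm]
  exact tsum_congr fun v => h v

theorem WSum.isPositive_sub_sum {B : ι → E →L[ℂ] E} {A : E →L[ℂ] E} (h : WSum B A)
    (hB : ∀ i, (B i).IsPositive) (hA : A.IsPositive) (T : Finset ι) :
    (A - ∑ i ∈ T, B i).IsPositive := by
  refine isPositive_of_qf_nonneg (hA.isSelfAdjoint.sub
    (ContinuousLinearMap.isPositive_sum T fun i _ => hB i).isSelfAdjoint) fun x => ?_
  rw [qf_sub, qf_sum, sub_nonneg, ← ENNReal.ofReal_le_ofReal_iff (qf_nonneg hA x), ← h x,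
    ENNReal.ofReal_sum_of_nonneg fun i _ => qf_nonneg (hB i) x]
  exact ENNReal.sum_le_tsum T

theorem traceENN_sum {B : ι → E →L[ℂ] E} (hB : ∀ i, (B i).IsPositive) (T : Finset ι) :
    traceENN (∑ i ∈ T, B i) = ∑ i ∈ T, traceENN (B i) := by
  induction T using Finset.induction_on with
  | empty => simp [traceENN, qf]
  | insert i T hi ih =>
    rw [Finset.sum_insert hi, Finset.sum_insert hi, traceENN_add (hB i)
      (ContinuousLinearMap.isPositive_sum T fun i _ => hB i), ih]

theorem WSum.traceENN_sub_sum_add {B : ι → E →L[ℂ] E} {A : E →L[ℂ] E} (h : WSum B A)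
    (hB : ∀ i, (B i).IsPositive) (hA : A.IsPositive) (T : Finset ι) :
    traceENN (A - ∑ i ∈ T, B i) + ∑ i ∈ T, traceENN (B i) = traceENN A := by
  rw [← traceENN_sum hB, ← traceENN_add (h.isPositive_sub_sum hB hA T)
    (ContinuousLinearMap.isPositive_sum T fun i _ => hB i), sub_add_cancel]

theorem WSum.traceENN_ne_top {B : ι → E →L[ℂ] E} {A : E →L[ℂ] E} (h : WSum B A)
    (hB : ∀ i, (B i).IsPositive) (hA : A ∈ posTC E) (i : ι) : traceENN (B i) ≠ ∞ := by
  refine ne_top_of_le_ne_top ((isTC_iff hA.1).1 hA.2) ?_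
  rw [← h.traceENN_eq hB hA.1]
  exact ENNReal.le_tsum i

theorem WSum.mem_posTC {B : ι → E →L[ℂ] E} {A : E →L[ℂ] E} (h : WSum B A)
    (hB : ∀ i, (B i).IsPositive) (hA : A ∈ posTC E) (i : ι) : B i ∈ posTC E :=
  ⟨hB i, (isTC_iff (hB i)).2 (h.traceENN_ne_top hB hA i)⟩

theorem WSum.tendsto_traceENN {B : ι → E →L[ℂ] E} {A : E →L[ℂ] E} (h : WSum B A)
    (hB : ∀ i, (B i).IsPositive) (hA : A ∈ posTC E) :
    Tendsto (fun T : Finset ι => traceENN (A - ∑ i ∈ T, B i)) atTop (𝓝 0) := by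
  have htop := (isTC_iff hA.1).1 hA.2
  have h1 : Tendsto (fun T : Finset ι => ∑ i ∈ T, traceENN (B i)) atTop (𝓝 (traceENN A)) := by
    rw [← h.traceENN_eq hB hA.1]
    exact ENNReal.summable.hasSum
  have h2 := ENNReal.Tendsto.sub (tendsto_const_nhds (x := traceENN A)) h1 (Or.inl htop)
  rw [tsub_self] at h2
  refine h2.congr fun T => ?_
  rw [← h.traceENN_sub_sum_add hB hA.1 T]
  refine ENNReal.add_sub_cancel_right (ne_top_of_le_ne_top htop ?_)
  rw [← h.traceENN_sub_sum_add hB hA.1 T]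
  exact le_add_self

theorem WSum.hasSum {B : ι → E →L[ℂ] E} {A : E →L[ℂ] E} (h : WSum B A)
    (hB : ∀ i, (B i).IsPositive) (hA : A ∈ posTC E) : HasSum B A := by
  refine tendsto_iff_norm_sub_tendsto_zero.2 ?_
  have h1 := (ENNReal.tendsto_toReal ENNReal.zero_ne_top).comp (h.tendsto_traceENN hB hA)
  refine squeeze_zero (fun T => norm_nonneg _) (fun T => ?_) h1
  have hp := h.isPositive_sub_sum hB hA.1 T
  have htop : traceENN (A - ∑ i ∈ T, B i) ≠ ∞ := by
    refine ne_top_of_le_ne_top ((isTC_iff hA.1).1 hA.2) ?_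
    rw [← h.traceENN_sub_sum_add hB hA.1 T]
    exact le_self_add
  rw [norm_sub_rev]
  exact (ENNReal.ofReal_le_iff_le_toReal htop).1 (ofReal_norm_le_traceENN hp)

/-- A positive trace-non-increasing map preserves weak sums. -/
theorem WSum.map {B : ι → E →L[ℂ] E} {A : E →L[ℂ] E} (h : WSum B A)
    (hB : ∀ i, (B i).IsPositive) (hA : A ∈ posTC E) {Φ : TraceMap E F} (hΦ : Φ.TNI) :
    WSum (fun i => Φ.toFun (B i)) (Φ.toFun A) := by
  have hBtc := h.mem_posTC hB hA
  have hrem : ∀ T : Finset ι, A - ∑ i ∈ T, B i ∈ posTC E := fun T => by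
    have hp := h.isPositive_sub_sum hB hA.1 T
    refine ⟨hp, (isTC_iff hp).2 (ne_top_of_le_ne_top ((isTC_iff hA.1).1 hA.2) ?_)⟩
    rw [← h.traceENN_sub_sum_add hB hA.1 T]
    exact le_self_add
  have hsumtc : ∀ T : Finset ι, IsTC (∑ i ∈ T, B i) := fun T => by
    rw [isTC_iff (ContinuousLinearMap.isPositive_sum T fun i _ => hB i), traceENN_sum hB]
    exact ENNReal.sum_ne_top.2 fun i _ => h.traceENN_ne_top hB hA i
  have hΦsum : ∀ T : Finset ι, Φ.toFun (∑ i ∈ T, B i) = ∑ i ∈ T, Φ.toFun (B i) := fun T => by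
    induction T using Finset.induction_on with
    | empty =>
      have := Φ.map_smul 0 A hA.2
      simpa using this
    | insert i T hi ih =>
      rw [Finset.sum_insert hi, Finset.sum_insert hi, Φ.map_add _ _ (hBtc i).2 (hsumtc T), ih]
  have hdec : ∀ T : Finset ι, ∀ y, ENNReal.ofReal (qf (Φ.toFun A) y) =
      ENNReal.ofReal (qf (Φ.toFun (A - ∑ i ∈ T, B i)) y) +
        ∑ i ∈ T, ENNReal.ofReal (qf (Φ.toFun (B i)) y) := fun T y => by
    have h1 : Φ.toFun A = Φ.toFun (A - ∑ i ∈ T, B i) + ∑ i ∈ T, Φ.toFun (B i) := by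
      rw [← hΦsum, ← Φ.map_add _ _ (hrem T).2 (hsumtc T), sub_add_cancel]
    have hpos : ∀ i, 0 ≤ qf (Φ.toFun (B i)) y := fun i =>
      qf_nonneg (Φ.pos _ (hBtc i).2 (hB i)) y
    rw [h1, qf_add, qf_sum, ENNReal.ofReal_add
      (qf_nonneg (Φ.pos _ (hrem T).2 (hrem T).1) y) (Finset.sum_nonneg fun i _ => hpos i),
      ENNReal.ofReal_sum_of_nonneg fun i _ => hpos i]
  intro y
  apply le_antisymm
  · rw [ENNReal.tsum_eq_iSup_sum]
    refine iSup_le fun T => ?_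
    rw [hdec T y]
    exact le_add_self
  · have hle : ∀ T : Finset ι, ENNReal.ofReal (qf (Φ.toFun A) y) ≤
        ENNReal.ofReal (‖y‖ ^ 2) * traceENN (A - ∑ i ∈ T, B i) +
          ∑' i, ENNReal.ofReal (qf (Φ.toFun (B i)) y) := fun T => by
      rw [hdec T y]
      refine add_le_add ((qf_le_traceENN (Φ.pos _ (hrem T).2 (hrem T).1) y).trans ?_)
        (ENNReal.sum_le_tsum T)
      exact mul_le_mul_right (hΦ _ (hrem T).2 (hrem T).1) _
    have hlim := (ENNReal.Tendsto.const_mul (h.tendsto_traceENN hB hA)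
      (Or.inr (ENNReal.ofReal_ne_top (r := ‖y‖ ^ 2)))).add_const
        (∑' i, ENNReal.ofReal (qf (Φ.toFun (B i)) y))
    rw [mul_zero, zero_add] at hlim
    exact ge_of_tendsto' hlim hle

theorem wsum_sqrt {A R : E →L[ℂ] E} (hRpos : R.IsPositive)
    (hR : ∀ x y, (inner ℂ x (A y) : ℂ) = inner ℂ (R x) (R y)) {s : Set E} (hs : IsONB s) :
    WSum (fun v : s => rankOne (R v)) A := by
  intro y
  rw [qf_eq_norm_sq hR, ← hs.tsum_norm_inner_sq]
  refine tsum_congr fun v => ?_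
  rw [qf_rankOne, hRpos.inner_left_eq_inner_right]

theorem isCompactOperator_rankOne (x : E) : IsCompactOperator (rankOne x) := by
  have h1 : IsCompactOperator (innerSL ℂ x) :=
    isCompactOperator_of_locallyCompactSpace_dom (innerSL ℂ x)
  exact h1.clm_comp ((1 : ℂ →L[ℂ] ℂ).smulRight x)

theorem isCompactOperator_of_mem_posTC {A : E →L[ℂ] E} (hA : A ∈ posTC E) :
    IsCompactOperator A := by
  obtain ⟨R, hRpos, hR⟩ := exists_positive_sqrt hA.1
  obtain ⟨s, hs⟩ := exists_isONB E
  have h := (wsum_sqrt hRpos hR hs).hasSum (fun v => isPositive_rankOne _) hA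
  refine isCompactOperator_of_tendsto h (Eventually.of_forall fun T => ?_)
  induction T using Finset.induction_on with
  | empty => simpa using isCompactOperator_zero
  | insert i T hi ih =>
    rw [Finset.sum_insert hi]
    exact (isCompactOperator_rankOne _).add ih

/-- An orthonormal basis consisting of eigenvectors of `A`. -/
def IsEigenONB (A : E →L[ℂ] E) (s : Set E) : Prop :=
  IsONB s ∧ ∀ v ∈ s, A v = (qf A v : ℂ) • v

theorem exists_isEigenONB {A : E →L[ℂ] E} (hA : A ∈ posTC E) : ∃ s, IsEigenONB A s := by
  have hsymm := hA.1.isSymmetric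
  have hbot := ContinuousLinearMap.orthogonalComplement_iSup_eigenspaces_eq_bot
    (isCompactOperator_of_mem_posTC hA) hsymm
  set V : ℂ → Submodule ℂ E := fun μ => Module.End.eigenspace (A : Module.End ℂ E) μ with hV
  have hmem : ∀ {μ x}, x ∈ V μ ↔ A x = μ • x := fun {μ x} => Module.End.mem_eigenspace_iff
  have hcl : ∀ μ, IsClosed (V μ : Set E) := fun μ => by
    have : (V μ : Set E) = {x | A x = μ • x} := by ext x; exact hmem
    rw [this]
    exact isClosed_eq A.continuous (continuous_const_smul μ)
  have hcs : ∀ μ, CompleteSpace (V μ) := fun μ => (hcl μ).completeSpace_coe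
  choose w hw using fun μ => exists_isONB (V μ)
  set s : Set E := ⋃ μ, ((↑) : V μ → E) '' w μ with hs
  have hnorm : ∀ v ∈ s, ‖v‖ = 1 := by
    intro v hv
    obtain ⟨μ, u, hu, rfl⟩ := Set.mem_iUnion.1 hv
    exact (hw μ).1.1 ⟨u, hu⟩
  refine ⟨s, ⟨⟨fun v => hnorm v v.2, ?_⟩, ?_⟩, ?_⟩
  · rintro ⟨x, hx⟩ ⟨y, hy⟩ hxy
    obtain ⟨μ, u, hu, rfl⟩ := Set.mem_iUnion.1 hx
    obtain ⟨ν, v, hv, rfl⟩ := Set.mem_iUnion.1 hy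
    rcases eq_or_ne μ ν with rfl | hne
    · have : (⟨u, hu⟩ : w μ) ≠ ⟨v, hv⟩ := by
        rintro h
        cases h
        exact hxy rfl
      exact (hw μ).1.2 this
    · exact hsymm.orthogonalFamily_eigenspaces hne u v
  · rw [Submodule.dense_iff_topologicalClosure_eq_top, Submodule.topologicalClosure_eq_top_iff,
      eq_bot_iff, ← hbot]
    rw [← Submodule.orthogonal_closure (Submodule.span ℂ s)]
    refine Submodule.orthogonal_le (iSup_le fun μ x hx => ?_)
    have hd := (hw μ).2 ⟨x, hx⟩
    have h1 := image_closure_subset_closure_image continuous_subtype_val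
      (Set.mem_image_of_mem ((↑) : V μ → E) hd)
    refine closure_mono ?_ h1
    rintro _ ⟨z, hz, rfl⟩
    have h2 : (z : E) ∈ (Submodule.span ℂ (w μ)).map (V μ).subtype := ⟨z, hz, rfl⟩
    rw [Submodule.map_span] at h2
    exact Submodule.span_mono (Set.subset_iUnion (fun μ => ((↑) : V μ → E) '' w μ) μ) h2
  · intro v hv
    have hn := hnorm v hv
    obtain ⟨μ, u, hu, rfl⟩ := Set.mem_iUnion.1 hv
    have hAu := hmem.1 u.2
    have hin : (inner ℂ (u : E) (A u) : ℂ) = μ := by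
      rw [hAu, inner_smul_right, inner_self_eq_norm_sq_to_K, hn]
      simp
    have him : (qf A u : ℂ) = inner ℂ (u : E) (A u) := by
      have := hA.1.inner_nonneg_right (u : E)
      exact (Complex.eq_re_of_ofReal_le this).symm
    rw [him, hin, hAu]

theorem IsEigenONB.wsum {A : E →L[ℂ] E} (hA : A.IsPositive) {s : Set E} (hs : IsEigenONB A s) :
    WSum (fun v : s => ((qf A v : ℝ) : ℂ) • rankOne (v : E)) A := by
  intro y
  obtain ⟨b, hb⟩ := hs.1.exists_hilbertBasis
  have h := Complex.hasSum_re (b.hasSum_inner_mul_inner y (A y))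
  have h1 : ∀ v : s, ((inner ℂ y (b v) : ℂ) * inner ℂ (b v) (A y)).re =
      qf (((qf A v : ℝ) : ℂ) • rankOne (v : E)) y := by
    intro v
    rw [hb, ← hA.inner_left_eq_inner_right, hs.2 v v.2, inner_smul_left, qf_smul, qf_rankOne,
      Complex.conj_ofReal, mul_left_comm, ← inner_conj_symm y, Complex.conj_mul']
    norm_cast
  simp only [h1] at h
  have hpos : ∀ v : s, 0 ≤ qf (((qf A v : ℝ) : ℂ) • rankOne (v : E)) y := fun v => by
    rw [qf_smul, qf_rankOne]
    exact mul_nonneg (qf_nonneg hA _) (by positivity)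
  rw [← ENNReal.ofReal_tsum_of_nonneg hpos h.summable, h.tsum_eq]
  rfl

end WeakSums

section Ensembles

variable {E F : Type*} [NormedAddCommGroup E] [InnerProductSpace ℂ E] [CompleteSpace E]
variable [NormedAddCommGroup F] [InnerProductSpace ℂ F] [CompleteSpace F]
variable {α : Type*}

theorem IsONB.norm_eq_one {s : Set E} (hs : IsONB s) (v : s) : ‖(v : E)‖ = 1 := hs.1.1 v

theorem IsEigenONB.qf_sum {D : E →L[ℂ] E} {s : Set E} (hs : IsEigenONB D s) (J : Finset s)
    (c : s → ℂ) : qf D (∑ v ∈ J, c v • (v : E)) = ∑ v ∈ J, ‖c v‖ ^ 2 * qf D v := by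
  have h1 : D (∑ v ∈ J, c v • (v : E)) = ∑ v ∈ J, (c v * (qf D v : ℂ)) • (v : E) := by
    rw [map_sum]
    refine Finset.sum_congr rfl fun v _ => ?_
    rw [map_smul, hs.2 v v.2, smul_smul]
  rw [qf, h1, hs.1.1.inner_sum, Complex.re_sum]
  refine Finset.sum_congr rfl fun v _ => ?_
  rw [← mul_assoc, Complex.conj_mul']
  norm_cast

theorem sum_norm_inner_sq_div_le_one {D : E →L[ℂ] E} (hD : D.IsPositive) {s : Set E}
    (hs : IsEigenONB D s) {x : E} (hx : ∀ y, ‖(inner ℂ x y : ℂ)‖ ^ 2 ≤ qf D y) (J : Finset s) :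
    ∑ v ∈ J, ‖(inner ℂ (v : E) x : ℂ)‖ ^ 2 / qf D v ≤ 1 := by
  set W := ∑ v ∈ J, ‖(inner ℂ (v : E) x : ℂ)‖ ^ 2 / qf D v with hW
  have hq := fun v : s => qf_nonneg hD (v : E)
  have hW0 : 0 ≤ W := Finset.sum_nonneg fun v _ => div_nonneg (by positivity) (hq v)
  set y := ∑ v ∈ J, ((inner ℂ (v : E) x : ℂ) / (qf D v : ℂ)) • (v : E) with hy
  have h1 : (inner ℂ x y : ℂ) = (W : ℂ) := by
    rw [hy, inner_sum, hW, Complex.ofReal_sum]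
    refine Finset.sum_congr rfl fun v _ => ?_
    rw [inner_smul_right, ← inner_conj_symm x, div_mul_eq_mul_div, Complex.mul_conj']
    push_cast
    rfl
  have h2 : qf D y = W := by
    rw [hy, hs.qf_sum, hW]
    refine Finset.sum_congr rfl fun v _ => ?_
    rw [norm_div, Complex.norm_real, Real.norm_of_nonneg (hq v), div_pow]
    rcases (hq v).eq_or_lt with h0 | h0
    · rw [← h0]; simp
    · field_simp
  have h3 := hx y
  rw [h1, h2, Complex.norm_real, Real.norm_of_nonneg hW0] at h3
  nlinarith

/-- The eigenvalues of `D` minimize the truncated entropy among all ensembles of vectors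
with weak sum `D`. -/
theorem tsum_truncTerm_le {D : E →L[ℂ] E} (hD : D.IsPositive) {s : Set E}
    (hs : IsEigenONB D s) {ψ : α → E} (hψ : WSum (fun a => rankOne (ψ a)) D) {L t : ℝ}
    (hL : 0 ≤ L) (ht : 0 ≤ t) (hDt : traceENN D ≤ ENNReal.ofReal t) :
    ∑' v : s, ENNReal.ofReal (truncTerm L t (qf D v)) ≤
      ∑' a, ENNReal.ofReal (truncTerm L t (‖ψ a‖ ^ 2)) := by
  have hq := fun v : s => qf_nonneg hD (v : E)
  have hqt : ∀ v : s, qf D v ≤ t := fun v => by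
    have h := (qf_le_traceENN hD (v : E)).trans (mul_le_mul_right hDt _)
    rw [hs.1.norm_eq_one v, one_pow, ENNReal.ofReal_one, one_mul] at h
    exact (ENNReal.ofReal_le_ofReal_iff ht).1 h
  have hψt : ∀ a, ‖ψ a‖ ^ 2 ≤ t := fun a => by
    have h := (ENNReal.le_tsum (f := fun a => traceENN (rankOne (ψ a))) a).trans
      ((hψ.traceENN_eq (fun a => isPositive_rankOne _) hD).le.trans hDt)
    rw [traceENN_rankOne] at h
    exact (ENNReal.ofReal_le_ofReal_iff ht).1 h
  have hle : ∀ a y, ‖(inner ℂ (ψ a) y : ℂ)‖ ^ 2 ≤ qf D y := fun a y => by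
    have h := (ENNReal.le_tsum (f := fun a => ENNReal.ofReal (qf (rankOne (ψ a)) y)) a).trans
      (hψ y).le
    rw [qf_rankOne] at h
    exact (ENNReal.ofReal_le_ofReal_iff (qf_nonneg hD y)).1 h
  set w : α → s → ℝ≥0∞ := fun a v =>
    ENNReal.ofReal (‖(inner ℂ (v : E) (ψ a) : ℂ)‖ ^ 2 / qf D v) with hw
  have hw1 : ∀ a, ∑' v, w a v ≤ 1 := fun a => by
    rw [ENNReal.tsum_eq_iSup_sum]
    refine iSup_le fun J => ?_
    rw [hw, ← ENNReal.ofReal_sum_of_nonneg fun v _ => div_nonneg (by positivity) (hq v),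
      ← ENNReal.ofReal_one]
    exact ENNReal.ofReal_le_ofReal (sum_norm_inner_sq_div_le_one hD hs (hle a) J)
  have hwmul : ∀ a v, w a v * ENNReal.ofReal (qf D v) =
      ENNReal.ofReal (‖(inner ℂ (v : E) (ψ a) : ℂ)‖ ^ 2) := fun a v => by
    rw [hw, ← ENNReal.ofReal_mul (div_nonneg (by positivity) (hq v))]
    rcases (hq v).eq_or_lt with h0 | h0
    · have h := hle a v
      rw [← h0, norm_inner_symm] at h
      rw [le_antisymm h (by positivity)]
      simp
    · rw [div_mul_cancel₀ _ h0.ne']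
  have hw2 : ∀ v : s, 0 < qf D v → ∑' a, w a v = 1 := fun v h0 => by
    have h := hψ (v : E)
    simp only [qf_rankOne] at h
    have h1 : (∑' a, w a v) * ENNReal.ofReal (qf D v) = ENNReal.ofReal (qf D v) := by
      rw [← ENNReal.tsum_mul_right]
      simp only [hwmul]
      rw [← h]
      exact tsum_congr fun a => by rw [norm_inner_symm]
    have hne : ENNReal.ofReal (qf D v) ≠ 0 := by simpa using h0
    exact (ENNReal.mul_left_inj hne ENNReal.ofReal_ne_top).1 (by rw [h1, one_mul])
  calc ∑' v : s, ENNReal.ofReal (truncTerm L t (qf D v))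
      = ∑' v : s, ∑' a, w a v * ENNReal.ofReal (truncTerm L t (qf D v)) := by
        refine tsum_congr fun v => ?_
        rcases (hq v).eq_or_lt with h0 | h0
        · rw [← h0]; simp [truncTerm]
        · rw [ENNReal.tsum_mul_right, hw2 v h0, one_mul]
    _ = ∑' a, ∑' v : s, w a v * ENNReal.ofReal (truncTerm L t (qf D v)) := ENNReal.tsum_comm
    _ ≤ ∑' a, ENNReal.ofReal (truncTerm L t (‖ψ a‖ ^ 2)) := by
        refine ENNReal.tsum_le_tsum fun a => ?_
        refine tsum_mul_truncTerm_le hq hqt (by positivity) (hψt a) hL (hw1 a) ?_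
        simp only [hwmul]
        exact hs.1.tsum_norm_inner_sq (ψ a)

/-- A sum of entropy summands is the limit of truncated sums. -/
theorem tsum_entTerm_le_of_truncTerm {x : α → ℝ} {t : ℝ} {M : ℝ≥0∞} (hx : ∀ a, 0 ≤ x a)
    (h : ∀ L : ℝ, 0 ≤ L → ∑' a, ENNReal.ofReal (truncTerm L t (x a)) ≤ M) :
    ∑' a, ENNReal.ofReal (entTerm t (x a)) ≤ M := by
  rw [ENNReal.tsum_eq_iSup_sum]
  refine iSup_le fun J => ?_
  set L := ∑ a ∈ J, |Real.log t - Real.log (x a)| with hLdef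
  refine le_trans (Finset.sum_le_sum fun a ha => ?_)
    ((ENNReal.sum_le_tsum J).trans (h L (Finset.sum_nonneg fun a _ => abs_nonneg _)))
  refine ENNReal.ofReal_le_ofReal (le_min le_rfl ?_)
  rw [entTerm, mul_comm]
  refine mul_le_mul_of_nonneg_right ?_ (hx a)
  exact (le_abs_self _).trans
    (Finset.single_le_sum (f := fun a => |Real.log t - Real.log (x a)|)
      (fun a _ => abs_nonneg _) ha)

theorem hasSum_norm_sq {D : E →L[ℂ] E} (hD : D ∈ posTC E) {ψ : α → E}
    (hψ : WSum (fun a => rankOne (ψ a)) D) :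
    HasSum (fun a => ‖ψ a‖ ^ 2) (traceENN D).toReal := by
  have h := (isTC_iff hD.1).1 hD.2
  rw [← hψ.traceENN_eq (fun a => isPositive_rankOne _) hD.1] at h ⊢
  simp only [traceENN_rankOne] at h ⊢
  have := ENNReal.hasSum_toReal h
  rw [← ENNReal.tsum_toReal_eq fun v => ENNReal.ofReal_ne_top] at this
  simpa [ENNReal.toReal_ofReal] using this

/-- The entropy of the spectrum of `D` is dominated by the entropy of any ensemble. -/
theorem IsEigenONB.clEntropy_le {D : E →L[ℂ] E} (hD : D ∈ posTC E) {s : Set E}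
    (hs : IsEigenONB D s) {ψ : α → E} (hψ : WSum (fun a => rankOne (ψ a)) D) :
    clEntropy (fun v : s => qf D v) ≤ clEntropy fun a => ‖ψ a‖ ^ 2 := by
  have htop := (isTC_iff hD.1).1 hD.2
  rw [clEntropy_eq (fun v => qf_nonneg hD.1 _) (hasSum_qf hD hs.1),
    clEntropy_eq (fun a => by positivity) (hasSum_norm_sq hD hψ)]
  refine tsum_entTerm_le_of_truncTerm (fun v => qf_nonneg hD.1 _) fun L hL => ?_
  refine (tsum_truncTerm_le hD.1 hs hψ hL ENNReal.toReal_nonneg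
    (ENNReal.ofReal_toReal htop).ge).trans (ENNReal.tsum_le_tsum fun a => ?_)
  exact ENNReal.ofReal_le_ofReal (truncTerm_le_entTerm _ _ _)

theorem qEntropy_le_clEntropy {D : E →L[ℂ] E} (hD : D ∈ posTC E) {ψ : α → E}
    (hψ : WSum (fun a => rankOne (ψ a)) D) : qEntropy D ≤ clEntropy fun a => ‖ψ a‖ ^ 2 := by
  obtain ⟨s, hs⟩ := exists_isEigenONB hD
  exact (iInf₂_le s hs.1).trans (hs.clEntropy_le hD hψ)

theorem IsEigenONB.qEntropy_eq {D : E →L[ℂ] E} (hD : D ∈ posTC E) {s : Set E}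
    (hs : IsEigenONB D s) : qEntropy D = clEntropy fun v : s => qf D v := by
  refine le_antisymm (iInf₂_le s hs.1) (le_iInf₂ fun u hu => ?_)
  obtain ⟨R, hRpos, hR⟩ := exists_positive_sqrt hD.1
  refine (hs.clEntropy_le hD (wsum_sqrt hRpos hR hu)).trans_eq ?_
  simp only [qf_eq_norm_sq hR]

theorem qEntropy_superadd {A B : E →L[ℂ] E} (hA : A ∈ posTC E) (hB : B ∈ posTC E) :
    qEntropy A + qEntropy B ≤ qEntropy (A + B) := by
  refine le_iInf₂ fun s hs => ?_
  simp only [qf_add]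
  exact (add_le_add (iInf₂_le s hs) (iInf₂_le s hs)).trans
    (clEntropy_superadd (fun v => qf_nonneg hA.1 _) (fun v => qf_nonneg hB.1 _)
      (hasSum_qf hA hs).summable (hasSum_qf hB hs).summable)

theorem qEntropy_smul (A : E →L[ℂ] E) {c : ℝ} (hc : 0 < c) :
    qEntropy ((c : ℂ) • A) = ENNReal.ofReal c * qEntropy A := by
  unfold qEntropy
  simp only [qf_smul, clEntropy_const_mul hc,
    ENNReal.mul_iInf_of_ne (ENNReal.ofReal_pos.2 hc).ne' ENNReal.ofReal_ne_top]

theorem rankOne_smul (c : ℂ) (x : E) :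
    rankOne (c • x) = ((‖c‖ ^ 2 : ℝ) : ℂ) • rankOne x := by
  ext y
  simp only [rankOne, ContinuousLinearMap.smulRight_apply, innerSL_apply_apply, inner_smul_left,
    smul_apply, smul_smul]
  congr 1
  rw [mul_right_comm, Complex.conj_mul']
  push_cast
  ring

theorem IsEigenONB.wsum_rankOne_sqrt {A : E →L[ℂ] E} (hA : A.IsPositive) {s : Set E}
    (hs : IsEigenONB A s) : WSum (fun v : s => rankOne (((√(qf A v) : ℝ) : ℂ) • (v : E))) A := by
  convert hs.wsum hA using 2 with v
  rw [rankOne_smul, Complex.norm_real, Real.norm_of_nonneg (Real.sqrt_nonneg _),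
    Real.sq_sqrt (qf_nonneg hA _)]

/-- The entropy of a weak sum is at most the sum of the entropies plus the entropy of the
family of traces. -/
theorem qEntropy_le_tsum_add {ι : Type*} {B : ι → E →L[ℂ] E} {A : E →L[ℂ] E} (h : WSum B A)
    (hB : ∀ i, (B i).IsPositive) (hA : A ∈ posTC E) :
    qEntropy A ≤ clEntropy (fun i => (traceENN (B i)).toReal) + ∑' i, qEntropy (B i) := by
  have hBtc := h.mem_posTC hB hA
  choose s hs using fun i => exists_isEigenONB (hBtc i)
  set ψ : (Σ i, s i) → E := fun p => ((√(qf (B p.1) p.2) : ℝ) : ℂ) • (p.2 : E) with hψ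
  have hw : WSum (fun p => rankOne (ψ p)) A := fun y => by
    rw [ENNReal.tsum_sigma', ← h y]
    exact tsum_congr fun i => (hs i).wsum_rankOne_sqrt (hB i) y
  have hn : ∀ p, ‖ψ p‖ ^ 2 = qf (B p.1) p.2 := fun p => by
    rw [hψ, norm_smul, (hs p.1).1.norm_eq_one p.2, mul_one, Complex.norm_real,
      Real.norm_of_nonneg (Real.sqrt_nonneg _), Real.sq_sqrt (qf_nonneg (hB _) _)]
  have ht : HasSum (fun i => (traceENN (B i)).toReal) (traceENN A).toReal := by
    have htop := (isTC_iff hA.1).1 hA.2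
    rw [← h.traceENN_eq hB hA.1] at htop ⊢
    have := ENNReal.hasSum_toReal htop
    rwa [← ENNReal.tsum_toReal_eq (h.traceENN_ne_top hB hA)] at this
  refine (qEntropy_le_clEntropy hA hw).trans_eq ?_
  simp only [hn, fun i => (hs i).qEntropy_eq (hBtc i)]
  exact clEntropy_sigma (x := fun i (v : s i) => qf (B i) v)
    (fun i v => qf_nonneg (hB i) _) (fun i => hasSum_qf (hBtc i) (hs i).1) ht

end Ensembles

section Semicontinuity

variable {E : Type*} [NormedAddCommGroup E] [InnerProductSpace ℂ E] [CompleteSpace E]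

theorem ofReal_le_ofReal_add_abs_sub (x y : ℝ) :
    ENNReal.ofReal x ≤ ENNReal.ofReal y + ENNReal.ofReal |x - y| :=
  (ENNReal.ofReal_le_ofReal (by linarith [le_abs_self (x - y)])).trans ENNReal.ofReal_add_le

theorem traceENN_le_add_traceNorm {A B : E →L[ℂ] E} (hA : A.IsPositive) (hB : B.IsPositive) :
    traceENN A ≤ traceENN B + traceNorm (A - B) := by
  obtain ⟨s, hs⟩ := exists_isONB E
  rw [traceENN_eq hA hs, traceENN_eq hB hs]
  refine le_trans ?_ (add_le_add le_rfl (tsum_abs_qf_sub_le A B hs))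
  rw [← ENNReal.tsum_add]
  exact ENNReal.tsum_le_tsum fun v => ofReal_le_ofReal_add_abs_sub _ _

theorem tsum_ofReal_qf_mul {A : E →L[ℂ] E} (hA : A ∈ posTC E) {s : Set E} (hs : IsONB s)
    (c : ℝ) :
    ∑' v : s, ENNReal.ofReal (qf A v * c) = ENNReal.ofReal ((traceENN A).toReal * c) := by
  simp only [ENNReal.ofReal_mul (qf_nonneg hA.1 _)]
  rw [ENNReal.tsum_mul_right, ← traceENN_eq hA.1 hs, ENNReal.ofReal_mul ENNReal.toReal_nonneg,
    ENNReal.ofReal_toReal ((isTC_iff hA.1).1 hA.2)]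

/-- The sum of the entropy summands of `C` relative to a total mass `t` at least its trace. -/
theorem tsum_entTerm_le {C : E →L[ℂ] E} (hC : C ∈ posTC E) {s : Set E} (hs : IsEigenONB C s)
    (t : ℝ) : ∑' v : s, ENNReal.ofReal (entTerm t (qf C v)) ≤
      qEntropy C + ENNReal.ofReal (entTerm t (traceENN C).toReal) := by
  rw [hs.qEntropy_eq hC, clEntropy_eq (fun v => qf_nonneg hC.1 _) (hasSum_qf hC hs.1), entTerm,
    ← tsum_ofReal_qf_mul hC hs.1, ← ENNReal.tsum_add]
  refine ENNReal.tsum_le_tsum fun v => ?_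
  rw [entTerm_change_left (traceENN C).toReal t]
  exact ENNReal.ofReal_add_le

theorem entTerm_mono_left {t t' x : ℝ} (hx : 0 ≤ x) (hxt : x ≤ t) (htt : t ≤ t') :
    entTerm t x ≤ entTerm t' x := by
  rcases hx.eq_or_lt with rfl | hx
  · simp
  · have := Real.log_le_log (by linarith) htt
    unfold entTerm
    gcongr

theorem entTerm_le_sub_of_le {t x : ℝ} (hx : 0 ≤ x) (hxt : x ≤ t) : entTerm t x ≤ t - x := by
  rcases (hx.trans hxt).eq_or_lt with rfl | ht
  · simp [le_antisymm hxt hx]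
  · exact entTerm_le_sub ht hx

/-- Lower semicontinuity of the entropy. -/
theorem qEntropy_lowerSemicontinuous {A₀ : E →L[ℂ] E} (hA₀ : A₀ ∈ posTC E)
    (hfin : qEntropy A₀ ≠ ∞) {ε : ℝ} (hε : 0 < ε) :
    ∃ δ : ℝ, 0 < δ ∧ ∀ B ∈ posTC E, traceNorm (B - A₀) < ENNReal.ofReal δ →
      qEntropy A₀ ≤ qEntropy B + ENNReal.ofReal ε := by
  obtain ⟨s, hs⟩ := exists_isEigenONB hA₀
  have htop := (isTC_iff hA₀.1).1 hA₀.2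
  set t₀ := (traceENN A₀).toReal with ht₀
  have hent : qEntropy A₀ = ∑' v : s, ENNReal.ofReal (entTerm t₀ (qf A₀ v)) := by
    rw [hs.qEntropy_eq hA₀, clEntropy_eq (fun v => qf_nonneg hA₀.1 _) (hasSum_qf hA₀ hs.1)]
  obtain ⟨L, hL, hLe⟩ : ∃ L : ℝ, 0 ≤ L ∧ qEntropy A₀ ≤
      ∑' v : s, ENNReal.ofReal (truncTerm L t₀ (qf A₀ v)) + ENNReal.ofReal (ε / 2) := by
    by_contra! hcon
    have h0 := hcon 0 le_rfl
    have h1 : qEntropy A₀ ≤ qEntropy A₀ - ENNReal.ofReal (ε / 2) := by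
      conv_lhs => rw [hent]
      refine tsum_entTerm_le_of_truncTerm (fun v => qf_nonneg hA₀.1 _) fun L hL => ?_
      exact ENNReal.le_sub_of_add_le_right ENNReal.ofReal_ne_top (hcon L hL).le
    refine absurd h1 (not_le.2 (ENNReal.sub_lt_self hfin (ne_of_gt (bot_lt_of_lt h0)) ?_))
    simpa using hε
  refine ⟨ε / (2 * (L + 2)), by positivity, fun B hB hBA => ?_⟩
  set δ := ε / (2 * (L + 2)) with hδ
  have hδ0 : 0 < δ := by positivity
  obtain ⟨u, hu⟩ := exists_isEigenONB hB
  set t := (traceENN B).toReal with ht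
  have htopB := (isTC_iff hB.1).1 hB.2
  have htt : t₀ ≤ t + δ := by
    have h := (traceENN_le_add_traceNorm hA₀.1 hB.1)
    rw [← traceNorm_neg, neg_sub] at h
    have h2 := h.trans (add_le_add le_rfl hBA.le)
    have h3 := ENNReal.toReal_mono (by simp [htopB]) h2
    rwa [ENNReal.toReal_add htopB ENNReal.ofReal_ne_top, ENNReal.toReal_ofReal hδ0.le] at h3
  set t' := max t t₀
  have ht0 : 0 ≤ t := ENNReal.toReal_nonneg
  have hqA : ∀ v : s, qf A₀ v ≤ t₀ := fun v =>
    le_hasSum (hasSum_qf hA₀ hs.1) v fun w _ => qf_nonneg hA₀.1 _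
  have hqB : ∀ v : u, qf B v ≤ t := fun v =>
    le_hasSum (hasSum_qf hB hu.1) v fun w _ => qf_nonneg hB.1 _
  obtain ⟨R, hRpos, hR⟩ := exists_positive_sqrt hA₀.1
  have step1 : ∑' v : s, ENNReal.ofReal (truncTerm L t₀ (qf A₀ v)) ≤
      ∑' v : s, ENNReal.ofReal (truncTerm L t' (qf A₀ v)) :=
    ENNReal.tsum_le_tsum fun v => ENNReal.ofReal_le_ofReal <| min_le_min
      (entTerm_mono_left (qf_nonneg hA₀.1 _) (hqA v) (le_max_right _ _)) le_rfl
  have step2 : ∑' v : s, ENNReal.ofReal (truncTerm L t' (qf A₀ v)) ≤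
      ∑' v : u, ENNReal.ofReal (truncTerm L t' (qf A₀ v)) := by
    have h := tsum_truncTerm_le hA₀.1 hs (wsum_sqrt hRpos hR hu.1) hL
      (ht0.trans (le_max_left t t₀)) (by
        rw [← ENNReal.ofReal_toReal htop]
        exact ENNReal.ofReal_le_ofReal (le_max_right _ _))
    simpa only [qf_eq_norm_sq hR] using h
  have step3 : ∑' v : u, ENNReal.ofReal (truncTerm L t' (qf A₀ v)) ≤
      ∑' v : u, ENNReal.ofReal (entTerm t' (qf B v)) +
        ENNReal.ofReal (L + 1) * ∑' v : u, ENNReal.ofReal |qf B v - qf A₀ v| := by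
    rw [← ENNReal.tsum_mul_left, ← ENNReal.tsum_add]
    refine ENNReal.tsum_le_tsum fun v => ?_
    rw [← ENNReal.ofReal_mul (by positivity)]
    refine le_trans (ENNReal.ofReal_le_ofReal ?_) ENNReal.ofReal_add_le
    exact (truncTerm_le_add hL (qf_nonneg hB.1 _) ((hqB v).trans (le_max_left _ _))
      (qf_nonneg hA₀.1 _)).trans (add_le_add (truncTerm_le_entTerm _ _ _) le_rfl)
  have step4 : ENNReal.ofReal (entTerm t' t) ≤ ENNReal.ofReal δ := by
    refine ENNReal.ofReal_le_ofReal ((entTerm_le_sub_of_le ht0 (le_max_left _ _)).trans ?_)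
    rw [sub_le_iff_le_add']
    exact max_le (by linarith) htt
  have hsum : ENNReal.ofReal δ + ENNReal.ofReal (L + 1) * ENNReal.ofReal δ +
      ENNReal.ofReal (ε / 2) = ENNReal.ofReal ε := by
    rw [← ENNReal.ofReal_mul (by positivity), ← ENNReal.ofReal_add (by positivity) (by positivity),
      ← ENNReal.ofReal_add (by positivity) (by positivity)]
    congr 1
    rw [hδ]
    field_simp
    ring
  calc qEntropy A₀
      ≤ ∑' v : s, ENNReal.ofReal (truncTerm L t₀ (qf A₀ v)) + ENNReal.ofReal (ε / 2) := hLe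
    _ ≤ (qEntropy B + ENNReal.ofReal δ + ENNReal.ofReal (L + 1) * ENNReal.ofReal δ) +
        ENNReal.ofReal (ε / 2) := by
        refine add_le_add ((step1.trans (step2.trans step3)).trans (add_le_add ?_ ?_)) le_rfl
        · exact (tsum_entTerm_le hB hu t').trans (add_le_add le_rfl step4)
        · exact mul_le_mul_right ((tsum_abs_qf_sub_le B A₀ hu.1).trans hBA.le) _
    _ = qEntropy B + ENNReal.ofReal ε := by rw [← hsum]; simp only [add_assoc]

end Semicontinuity

section Approximators

variable {E F : Type*} [NormedAddCommGroup E] [InnerProductSpace ℂ E] [CompleteSpace E]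
variable [NormedAddCommGroup F] [InnerProductSpace ℂ F] [CompleteSpace F]

theorem IsONB.countable [TopologicalSpace.SeparableSpace E] {s : Set E} (hs : IsONB s) :
    s.Countable := by
  refine Set.PairwiseDisjoint.countable_of_isOpen (s := fun v : E => Metric.ball v (1 / 2)) ?_
    (fun v _ => Metric.isOpen_ball) fun v _ => ⟨v, Metric.mem_ball_self (by norm_num)⟩
  intro v hv w hw hvw
  refine Metric.ball_disjoint_ball ?_
  have h0 : (inner ℂ v w : ℂ) = 0 :=
    hs.1.2 (i := ⟨v, hv⟩) (j := ⟨w, hw⟩) fun h => hvw (Subtype.ext_iff.1 h)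
  have h1 := @norm_sub_sq ℂ E _ _ _ v w
  rw [h0, hs.norm_eq_one ⟨v, hv⟩, hs.norm_eq_one ⟨w, hw⟩] at h1
  simp only [map_zero, mul_zero, sub_zero] at h1
  rw [dist_eq_norm]
  nlinarith [norm_nonneg (v - w)]

theorem rankLE_of_range_subset {A : E →L[ℂ] E} {k : ℕ} {T : Finset E} (hT : T.card ≤ k)
    (h : ∀ x, A x ∈ Submodule.span ℂ (T : Set E)) : rankLE A k := by
  have h1 : LinearMap.range (A : E →ₗ[ℂ] E) ≤ Submodule.span ℂ (T : Set E) := by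
    rintro _ ⟨x, rfl⟩
    exact h x
  exact (Submodule.rank_mono h1).trans ((rank_span_finset_le T).trans (by exact_mod_cast hT))

theorem rankOne_apply (x y : E) : rankOne x y = (inner ℂ x y : ℂ) • x := by
  simp [rankOne]

theorem rankLE_smul_rankOne (c : ℂ) (x : E) {k : ℕ} (hk : 1 ≤ k) : rankLE (c • rankOne x) k := by
  refine rankLE_of_range_subset (T := {x}) (by simpa using hk) fun y => ?_
  rw [smul_apply, rankOne_apply]
  exact Submodule.smul_mem _ _ (Submodule.smul_mem _ _ (Submodule.subset_span (by simp)))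

theorem rankLE_sum_rankOne {ι : Type*} (T : Finset ι) (f : ι → E) {k : ℕ} (hk : T.card ≤ k) :
    rankLE (∑ i ∈ T, rankOne (f i)) k := by
  refine rankLE_of_range_subset (T := T.image f) (Finset.card_image_le.trans hk) fun y => ?_
  rw [sum_apply]
  refine Submodule.sum_mem _ fun i hi => ?_
  rw [rankOne_apply]
  exact Submodule.smul_mem _ _ (Submodule.subset_span (by simpa using ⟨i, hi, rfl⟩))

theorem rankLE_smul {A : E →L[ℂ] E} {k : ℕ} (hA : rankLE A k) (c : ℂ) : rankLE (c • A) k := by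
  refine (Submodule.rank_mono ?_).trans hA
  rintro _ ⟨x, rfl⟩
  exact Submodule.smul_mem _ c ⟨x, rfl⟩

theorem isPositive_smul {A : E →L[ℂ] E} (hA : A.IsPositive) {c : ℝ} (hc : 0 ≤ c) :
    ((c : ℂ) • A).IsPositive :=
  hA.smul_of_nonneg (by exact_mod_cast hc)

theorem isPositive_smul_rankOne (x : E) {c : ℝ} (hc : 0 ≤ c) :
    ((c : ℂ) • rankOne x).IsPositive :=
  isPositive_smul (isPositive_rankOne x) hc

/-- The `k`-order approximator dominates the sum of output entropies over any countable
family of operators of rank at most `k` with sum `A`. -/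
theorem tsum_qEntropy_le_kApprox {ι : Type*} [Countable ι] {B : ι → E →L[ℂ] E} {A : E →L[ℂ] E}
    (h : WSum B A) (hB : ∀ i, (B i).IsPositive) (hA : A ∈ posTC E) {k : ℕ}
    (hk : ∀ i, rankLE (B i) k) (Φ : TraceMap E F) :
    ∑' i, qEntropy (Φ.toFun (B i)) ≤ kApprox Φ.toFun k A := by
  obtain ⟨f, hf⟩ := Countable.exists_injective_nat ι
  set B' : ℕ → E →L[ℂ] E := Function.extend f B 0 with hB'
  have hcases : ∀ n, (∃ i, B' n = B i) ∨ B' n = 0 := fun n => by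
    by_cases hn : ∃ i, f i = n
    · obtain ⟨i, rfl⟩ := hn
      exact .inl ⟨i, hf.extend_apply _ _ _⟩
    · exact .inr (Function.extend_apply' _ _ _ hn)
  have hpos : ∀ n, (B' n).IsPositive := fun n => by
    rcases hcases n with ⟨i, hi⟩ | h0
    · exact hi ▸ hB i
    · exact h0 ▸ ContinuousLinearMap.isPositive_zero
  have hrank : ∀ n, rankLE (B' n) k := fun n => by
    rcases hcases n with ⟨i, hi⟩ | h0
    · exact hi ▸ hk i
    · rw [h0]
      exact rankLE_of_range_subset (T := ∅) (by simp) (by simp)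
  have hw : WSum B' A := fun y => by
    rw [← h y, ← tsum_extend_zero hf]
    refine tsum_congr fun n => ?_
    by_cases hn : ∃ i, f i = n
    · obtain ⟨i, rfl⟩ := hn
      rw [hB', hf.extend_apply, hf.extend_apply]
    · rw [hB', Function.extend_apply' _ _ _ hn, Function.extend_apply' _ _ _ hn]
      simp [qf]
  have hπ : ∀ n : ℕ, (0 : ℝ) < 1 / 2 / 2 ^ n := fun n => by positivity
  set d : Decomp k A :=
    { π := fun n => 1 / 2 / 2 ^ n
      op := fun n => (((1 / 2 / 2 ^ n : ℝ)⁻¹ : ℝ) : ℂ) • B' n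
      π_nonneg := fun n => (hπ n).le
      π_sum := hasSum_geometric_two' 1
      op_pos := fun n => isPositive_smul (hpos n) (inv_pos.2 (hπ n)).le
      op_rank := fun n => rankLE_smul (hrank n) _
      sum_eq := by
        convert hw.hasSum hpos hA using 2 with n
        rw [← Complex.coe_smul, smul_smul, ← Complex.ofReal_mul, mul_inv_cancel₀ (hπ n).ne',
          Complex.ofReal_one, one_smul] } with hd
  refine le_trans ?_ (le_iSup _ d)
  calc ∑' i, qEntropy (Φ.toFun (B i))
      = ∑' i, qEntropy (Φ.toFun (B' (f i))) :=
        tsum_congr fun i => by rw [hB', hf.extend_apply]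
    _ ≤ ∑' n, qEntropy (Φ.toFun (B' n)) :=
        ENNReal.tsum_comp_le_tsum_of_injective hf fun n => qEntropy (Φ.toFun (B' n))
    _ = ∑' n, ENNReal.ofReal (d.π n) * qEntropy (Φ.toFun (d.op n)) := by
        refine tsum_congr fun n => ?_
        simp only [hd]
        rw [Φ.map_smul _ _ (hw.mem_posTC hpos hA n).2, qEntropy_smul _ (inv_pos.2 (hπ n)),
          ← mul_assoc, ← ENNReal.ofReal_mul (hπ n).le, mul_inv_cancel₀ (hπ n).ne',
          ENNReal.ofReal_one, one_mul]

theorem tsum_punit_sum {ι : Type*} (f : PUnit.{1} ⊕ ι → ℝ≥0∞) :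
    ∑' i, f i = f (.inl ⟨⟩) + ∑' i, f (.inr i) := by
  rw [Summable.tsum_sum ENNReal.summable ENNReal.summable]
  simp

/-- Splitting off a part `B` of rank at most `k` estimates the output entropy by the
`k`-order approximator, uniformly in the map. -/
theorem outEntropy_le_kApprox_add [TopologicalSpace.SeparableSpace E] {B C : E →L[ℂ] E}
    (hB : B ∈ posTC E) (hC : C ∈ posTC E) (hBC : B + C ∈ posTC E) {k : ℕ} (hk : 1 ≤ k)
    (hrank : rankLE B k) {Φ : TraceMap E F} (hΦ : Φ.TNI) :
    outEntropy Φ (B + C) ≤ kApprox Φ.toFun k (B + C) +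
      (ENNReal.ofReal (entTerm (traceENN (B + C)).toReal (traceENN B).toReal) +
        (qEntropy C +
          ENNReal.ofReal (entTerm (traceENN (B + C)).toReal (traceENN C).toReal))) := by
  obtain ⟨s, hs⟩ := exists_isEigenONB hC
  have := hs.1.countable.to_subtype
  set D : PUnit.{1} ⊕ s → E →L[ℂ] E :=
    Sum.elim (fun _ => B) fun v => ((qf C v : ℝ) : ℂ) • rankOne (v : E) with hD
  have hDpos : ∀ i, (D i).IsPositive := by
    rintro (_ | v)
    · exact hB.1
    · exact isPositive_smul_rankOne _ (qf_nonneg hC.1 _)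
  have hDrank : ∀ i, rankLE (D i) k := by
    rintro (_ | v)
    · exact hrank
    · exact rankLE_smul_rankOne _ _ hk
  have hw : WSum D (B + C) := fun y => by
    rw [tsum_punit_sum, qf_add, ENNReal.ofReal_add (qf_nonneg hB.1 y) (qf_nonneg hC.1 y)]
    exact congrArg _ (hs.wsum hC.1 y)
  have hDtop := hw.traceENN_ne_top hDpos hBC
  have hDtc := hw.mem_posTC hDpos hBC
  have htr : HasSum (fun i => (traceENN (D i)).toReal) (traceENN (B + C)).toReal := by
    have htop := (isTC_iff hBC.1).1 hBC.2
    rw [← hw.traceENN_eq hDpos hBC.1] at htop ⊢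
    have := ENNReal.hasSum_toReal htop
    rwa [← ENNReal.tsum_toReal_eq hDtop] at this
  have htrv : ∀ v : s, (traceENN (D (.inr v))).toReal = qf C v := fun v => by
    have h1 : D (.inr v) = rankOne (((√(qf C v) : ℝ) : ℂ) • (v : E)) := by
      rw [rankOne_smul, Complex.norm_real, Real.norm_of_nonneg (Real.sqrt_nonneg _),
        Real.sq_sqrt (qf_nonneg hC.1 _)]
      rfl
    rw [h1, traceENN_rankOne, norm_smul, hs.1.norm_eq_one, mul_one, Complex.norm_real,
      Real.norm_of_nonneg (Real.sqrt_nonneg _), Real.sq_sqrt (qf_nonneg hC.1 _),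
      ENNReal.toReal_ofReal (qf_nonneg hC.1 _)]
  have hΦA : Φ.toFun (B + C) ∈ posTC F := ⟨Φ.pos _ hBC.2 hBC.1, Φ.maps_tc _ hBC.2⟩
  refine (qEntropy_le_tsum_add (hw.map hDpos hBC hΦ)
    (fun i => Φ.pos _ (hDtc i).2 (hDpos i)) hΦA).trans ?_
  rw [add_comm]
  refine add_le_add (tsum_qEntropy_le_kApprox hw hDpos hBC hDrank Φ) ?_
  refine (clEntropy_mono (fun i => ENNReal.toReal_nonneg) (fun i => ENNReal.toReal_mono (hDtop i)
    (hΦ _ (hDtc i).2 (hDpos i))) htr.summable).trans ?_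
  rw [clEntropy_eq (fun i => ENNReal.toReal_nonneg) htr, tsum_punit_sum]
  refine add_le_add le_rfl ?_
  simp only [htrv]
  exact tsum_entTerm_le hC hs _

end Approximators

section UniformApproximation

variable {E F : Type*} [NormedAddCommGroup E] [InnerProductSpace ℂ E] [CompleteSpace E]
variable [NormedAddCommGroup F] [InnerProductSpace ℂ F] [CompleteSpace F]

/-- The trace of the remainder `A - ∑_T |√A v⟩⟨√A v|` is the corresponding tail of the diagonal. -/
theorem traceENN_sub_sum_rankOne_sqrt {A R : E →L[ℂ] E} (hA : A ∈ posTC E)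
    (hRpos : R.IsPositive) (hR : ∀ x y, (inner ℂ x (A y) : ℂ) = inner ℂ (R x) (R y))
    {s : Set E} (hs : IsONB s) (T : Finset s) :
    traceENN (A - ∑ v ∈ T, rankOne (R v)) =
      ∑' v : { v // v ∉ T }, ENNReal.ofReal (qf A (v : s)) := by
  have h := (wsum_sqrt hRpos hR hs).traceENN_sub_sum_add (fun v => isPositive_rankOne _) hA.1 T
  simp only [traceENN_rankOne, ← qf_eq_norm_sq hR] at h
  rw [traceENN_eq hA.1 hs, ← ENNReal.sum_add_tsum_compl T, add_comm] at h
  exact (ENNReal.add_right_inj (ENNReal.sum_ne_top.2 fun v _ => ENNReal.ofReal_ne_top)).1 h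

theorem tsum_subtype_qf_le {A B : E →L[ℂ] E} {s : Set E} (hs : IsONB s) (p : s → Prop) :
    ∑' v : { v // p v }, ENNReal.ofReal (qf A (v : s)) ≤
      ∑' v : { v // p v }, ENNReal.ofReal (qf B (v : s)) + traceNorm (A - B) := by
  refine le_trans ?_ (add_le_add le_rfl ((ENNReal.tsum_comp_le_tsum_of_injective
    (Subtype.val_injective (p := p)) fun v : s => ENNReal.ofReal |qf A v - qf B v|).trans
      (tsum_abs_qf_sub_le A B hs)))
  rw [← ENNReal.tsum_add]
  exact ENNReal.tsum_le_tsum fun v => ofReal_le_ofReal_add_abs_sub _ _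

/-- Uniform approximation in a neighbourhood of a point of continuity of the entropy. -/
theorem exists_local_approximation [TopologicalSpace.SeparableSpace E]
    {𝒜 : Set (E →L[ℂ] E)} (h𝒜 : 𝒜 ⊆ posTC E) (hent : ContOn qEntropy 𝒜) {A₀ : E →L[ℂ] E}
    (hA₀ : A₀ ∈ 𝒜) {ε : ℝ} (hε : 0 < ε) :
    ∃ δ : ℝ, 0 < δ ∧ ∃ K : ℕ, ∀ A ∈ 𝒜, traceNorm (A - A₀) < ENNReal.ofReal δ → ∀ k ≥ K,
      ∀ Φ : TraceMap E F, Φ.TNI →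
        outEntropy Φ A ≤ kApprox Φ.toFun k A + ENNReal.ofReal ε := by
  have hP₀ := h𝒜 hA₀
  have htop₀ := (isTC_iff hP₀.1).1 hP₀.2
  set t₀ := (traceENN A₀).toReal with ht₀
  have ht₀0 : 0 ≤ t₀ := ENNReal.toReal_nonneg
  obtain ⟨δ₁, hδ₁, hcont⟩ := hent.2 A₀ hA₀ (ε / 4) (by positivity)
  obtain ⟨δ₂, hδ₂, hlsc⟩ := qEntropy_lowerSemicontinuous hP₀ (hent.1 A₀ hA₀)
    (show 0 < ε / 4 by positivity)
  obtain ⟨η, hη, hη1, hη2, hη3⟩ : ∃ η : ℝ, 0 < η ∧ η ≤ ε / 4 ∧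
      (t₀ + 1) * η ≤ (ε / 8) ^ 2 ∧ η ≤ δ₂ / 2 := by
    refine ⟨min (ε / 4) (min ((ε / 8) ^ 2 / (t₀ + 1)) (δ₂ / 2)), by positivity,
      min_le_left _ _, ?_, (min_le_right _ _).trans (min_le_right _ _)⟩
    rw [mul_comm, ← le_div_iff₀ (by positivity)]
    exact (min_le_right _ _).trans (min_le_left _ _)
  obtain ⟨s, hs⟩ := exists_isONB E
  obtain ⟨T, hT⟩ : ∃ T : Finset s,
      ∑' v : { v // v ∉ T }, ENNReal.ofReal (qf A₀ (v : s)) < ENNReal.ofReal (η / 2) := by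
    have h := ENNReal.tendsto_tsum_compl_atTop_zero (traceENN_eq hP₀.1 hs ▸ htop₀)
    exact (h.eventually_lt_const (ENNReal.ofReal_pos.2 (half_pos hη))).exists
  refine ⟨min δ₁ (min (η / 2) 1), by positivity, T.card + 1, fun A hA hAA k hk Φ hΦ => ?_⟩
  have hAA1 := hAA.trans_le (ENNReal.ofReal_le_ofReal (min_le_left _ _))
  have hAA2 := hAA.trans_le
    (ENNReal.ofReal_le_ofReal ((min_le_right _ _).trans (min_le_left _ _)))
  have hAA3 := hAA.trans_le
    (ENNReal.ofReal_le_ofReal ((min_le_right _ _).trans (min_le_right _ _)))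
  have hP := h𝒜 hA
  have htop := (isTC_iff hP.1).1 hP.2
  obtain ⟨R, hRpos, hR⟩ := exists_positive_sqrt hP.1
  have hw := wsum_sqrt hRpos hR hs
  set B := ∑ v ∈ T, rankOne (R v) with hB
  set C := A - B with hC
  have hBC : B + C = A := add_sub_cancel B A
  have hBpos : B.IsPositive :=
    ContinuousLinearMap.isPositive_sum T fun v _ => isPositive_rankOne _
  have hCpos : C.IsPositive := hw.isPositive_sub_sum (fun v => isPositive_rankOne _) hP.1 T
  have htr : traceENN B + traceENN C = traceENN A := by rw [← traceENN_add hBpos hCpos, hBC]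
  have hBtop : traceENN B ≠ ∞ := ne_top_of_le_ne_top htop (htr ▸ le_self_add)
  have hCtop : traceENN C ≠ ∞ := ne_top_of_le_ne_top htop (htr ▸ le_add_self)
  have hBtc : B ∈ posTC E := ⟨hBpos, (isTC_iff hBpos).2 hBtop⟩
  have hCtc : C ∈ posTC E := ⟨hCpos, (isTC_iff hCpos).2 hCtop⟩
  have hCη : traceENN C ≤ ENNReal.ofReal η := by
    rw [hC, hB, traceENN_sub_sum_rankOne_sqrt hP hRpos hR hs T]
    refine (tsum_subtype_qf_le hs _).trans ((add_le_add hT.le hAA2.le).trans_eq ?_)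
    rw [← ENNReal.ofReal_add (by positivity) (by positivity), add_halves]
  have htrR : (traceENN B).toReal + (traceENN C).toReal = (traceENN A).toReal := by
    rw [← htr, ENNReal.toReal_add hBtop hCtop]
  have hCηR : (traceENN C).toReal ≤ η := ENNReal.toReal_le_of_le_ofReal hη.le hCη
  have hAt : (traceENN A).toReal ≤ t₀ + 1 := by
    have h := (traceENN_le_add_traceNorm hP.1 hP₀.1).trans (add_le_add le_rfl hAA3.le)
    have h3 := ENNReal.toReal_mono (by simp [htop₀]) h
    rwa [ENNReal.toReal_add htop₀ ENNReal.ofReal_ne_top, ENNReal.toReal_ofReal zero_le_one] at h3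
  have hB0 : 0 ≤ (traceENN B).toReal := ENNReal.toReal_nonneg
  have hC0 : 0 ≤ (traceENN C).toReal := ENNReal.toReal_nonneg
  have hterm1 : entTerm (traceENN A).toReal (traceENN B).toReal ≤ ε / 4 :=
    (entTerm_le_sub_of_le hB0 (by linarith)).trans (by linarith)
  have hterm2 : entTerm (traceENN A).toReal (traceENN C).toReal ≤ ε / 4 := by
    refine (entTerm_le_two_mul_sqrt hC0 (by linarith)).trans ?_
    have h : √((traceENN A).toReal * (traceENN C).toReal) ≤ ε / 8 := by
      refine Real.sqrt_le_iff.2 ⟨by positivity, le_trans ?_ hη2⟩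
      gcongr
    linarith
  have hBA : traceNorm (B - A₀) < ENNReal.ofReal δ₂ := by
    have h : B - A₀ = -C + (A - A₀) := by rw [hC]; abel
    have h1 : traceNorm (B - A₀) ≤ traceENN C + traceNorm (A - A₀) := by
      rw [h, ← traceNorm_eq_traceENN hCpos, ← traceNorm_neg C]
      exact traceNorm_add_le _ _
    refine h1.trans_lt ((ENNReal.add_lt_add_of_le_of_lt hCtop hCη hAA2).trans_le ?_)
    rw [← ENNReal.ofReal_add (by positivity) (by positivity)]
    exact ENNReal.ofReal_le_ofReal (by linarith)
  have hHC : qEntropy C ≤ ENNReal.ofReal (ε / 2) := by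
    have hsup : qEntropy B + qEntropy C ≤ qEntropy A := by
      rw [← hBC]
      exact qEntropy_superadd hBtc hCtc
    have hle : qEntropy A ≤ qEntropy A₀ + ENNReal.ofReal (ε / 4) := by
      have h := (abs_lt.1 (hcont A hA hAA1)).2
      rw [← ENNReal.ofReal_toReal (hent.1 A hA), ← ENNReal.ofReal_toReal (hent.1 A₀ hA₀),
        ← ENNReal.ofReal_add ENNReal.toReal_nonneg (by positivity)]
      exact ENNReal.ofReal_le_ofReal (by linarith)
    have hBfin : qEntropy B ≠ ∞ := ne_top_of_le_ne_top (hent.1 A hA) (le_self_add.trans hsup)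
    refine (ENNReal.add_le_add_iff_left hBfin).1 ((hsup.trans hle).trans
      ((add_le_add (hlsc B hBtc hBA) le_rfl).trans_eq ?_))
    rw [add_assoc, ← ENNReal.ofReal_add (by positivity) (by positivity)]
    congr 2
    ring
  have hmain := outEntropy_le_kApprox_add hBtc hCtc (hBC.symm ▸ hP) (by omega : 1 ≤ k)
    (rankLE_sum_rankOne T (fun v : s => R v) (by omega)) hΦ
  rw [hBC] at hmain
  refine hmain.trans (add_le_add le_rfl ((add_le_add (ENNReal.ofReal_le_ofReal hterm1)
    (add_le_add hHC (ENNReal.ofReal_le_ofReal hterm2))).trans_eq ?_))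
  rw [← ENNReal.ofReal_add (by positivity) (by positivity),
    ← ENNReal.ofReal_add (by positivity) (by positivity)]
  congr 1
  ring

end UniformApproximation

/-- Lemma 2 of the paper. If the quantum entropy is continuous on a
compact subset `𝒜` of `𝔗₊(ℋ)`, then the `k`-order approximators of the output entropy
converge to the output entropy uniformly on `𝒜`, uniformly over all positive linear
trace-non-increasing maps `Φ`. -/
theorem statement9
    {E F : Type*}
    [NormedAddCommGroup E] [InnerProductSpace ℂ E] [CompleteSpace E]
    [TopologicalSpace.SeparableSpace E]
    [NormedAddCommGroup F] [InnerProductSpace ℂ F] [CompleteSpace F]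
    [TopologicalSpace.SeparableSpace F]
    (𝒜 : Set (E →L[ℂ] E)) (h𝒜 : 𝒜 ⊆ posTC E) (hcmp : TNCompact 𝒜)
    (hent : ContOn qEntropy 𝒜) :
    ∀ ε : ℝ, 0 < ε → ∃ K : ℕ, ∀ k ≥ K, ∀ Φ : TraceMap E F, Φ.TNI → ∀ A ∈ 𝒜,
      outEntropy Φ A ≤ kApprox Φ.toFun k A + ENNReal.ofReal ε := by
  intro ε hε
  by_contra! hcon
  choose k hk Φ hΦ A hA hlt using hcon
  obtain ⟨A₀, hA₀, φ, hφ, hlim⟩ := hcmp A hA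
  obtain ⟨δ, hδ, K, hloc⟩ := exists_local_approximation (F := F) h𝒜 hent hA₀ hε
  obtain ⟨N, hN⟩ := hlim δ hδ
  set n := max N K
  have hK : k (φ n) ≥ K := (le_max_right N K).trans ((hφ.le_apply).trans (hk (φ n)))
  exact (hlt (φ n)).not_ge
    (hloc _ (hA (φ n)) (hN n (le_max_left _ _)) _ hK _ (hΦ (φ n)))

end QIT
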